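/- arXiv:2509.11494 — 4 statements merged into one kernel-verified Lean document; each statement's English description precedes it below -/
import Mathlib

section
/- For all n ≥ k ≥ 1: the number of Jacobi permutations π of [2n] avoiding 213 with last letter π_{2n} = k equals (2k/(3n−k))·C(3n−k, 2n), and the number of Jacobi permutations π of [2n−1] avoiding 213 with last letter π_{2n−1} = k equals ((2k−1)/(3n−k−1))·C(3n−k−1, 2n−1). -/
/-- The length of `ρ_π(π_k)`: the maximal consecutive subword of `π` immediately to the
right of position `k`, all of whose letters are larger than `π_k`.  Letters of a
permutation of `[n] = {1,…,n}` are modelled by `(π i : ℕ) + 1` for `π : Equiv.Perm (Fin n)`. -/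
noncomputable def rhoLen {n : ℕ} (π : Equiv.Perm (Fin n)) (k : Fin n) : ℕ :=
  Nat.card {j : Fin n // k < j ∧ ∀ i : Fin n, k < i → i ≤ j → π k < π i}

/-- A permutation is Jacobi if `ρ_π(π_k)` has even length for every position `k`. -/
def IsJacobi {n : ℕ} (π : Equiv.Perm (Fin n)) : Prop :=
  ∀ k : Fin n, Even (rhoLen π k)

/-- `π` avoids the pattern `123`. -/
def Avoids123 {n : ℕ} (π : Equiv.Perm (Fin n)) : Prop :=
  ¬ ∃ i j k : Fin n, i < j ∧ j < k ∧ π i < π j ∧ π j < π k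

/-- `π` avoids the pattern `132`. -/
def Avoids132 {n : ℕ} (π : Equiv.Perm (Fin n)) : Prop :=
  ¬ ∃ i j k : Fin n, i < j ∧ j < k ∧ π i < π k ∧ π k < π j

/-- `π` avoids the pattern `213`. -/
def Avoids213 {n : ℕ} (π : Equiv.Perm (Fin n)) : Prop :=
  ¬ ∃ i j k : Fin n, i < j ∧ j < k ∧ π j < π i ∧ π i < π k

/-- `π` avoids the pattern `231`. -/
def Avoids231 {n : ℕ} (π : Equiv.Perm (Fin n)) : Prop :=
  ¬ ∃ i j k : Fin n, i < j ∧ j < k ∧ π k < π i ∧ π i < π j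

/-- `π` avoids the pattern `312`. -/
def Avoids312 {n : ℕ} (π : Equiv.Perm (Fin n)) : Prop :=
  ¬ ∃ i j k : Fin n, i < j ∧ j < k ∧ π j < π k ∧ π k < π i

/-- `π` avoids the pattern `321`. -/
def Avoids321 {n : ℕ} (π : Equiv.Perm (Fin n)) : Prop :=
  ¬ ∃ i j k : Fin n, i < j ∧ j < k ∧ π k < π j ∧ π j < π i

/-- The last letter of `π`, as an element of `[n] = {1,…,n}` (junk value `0` if `n = 0`). -/
def lastVal {n : ℕ} (π : Equiv.Perm (Fin n)) : ℕ :=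
  if h : 0 < n then (π ⟨n - 1, Nat.sub_lt h Nat.one_pos⟩ : ℕ) + 1 else 0

open Finset in
theorem J_sum_even (n : ℕ) (h : ℕ → ℕ) :
    ∑ r ∈ range (2 * n + 1), (if Even r then h r else 0) = ∑ i ∈ range (n + 1), h (2 * i) := by
  induction n with
  | zero => simp
  | succ n ih =>
    rw [show 2 * (n + 1) + 1 = (2 * n + 1) + 1 + 1 by ring, sum_range_succ, sum_range_succ, ih,
      sum_range_succ _ (n + 1)]
    have h1 : ¬ Even (2 * n + 1) := by simp
    have h2 : Even (2 * n + 1 + 1) := ⟨n + 1, by ring⟩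
    rw [if_neg h1, if_pos h2]
    simp [mul_add]

open Finset in
theorem J_sum_odd (n : ℕ) (h : ℕ → ℕ) :
    ∑ r ∈ range (2 * n + 1 + 1), (if Even r then h r else 0)
      = ∑ i ∈ range (n + 1), h (2 * i) := by
  rw [sum_range_succ, J_sum_even]
  simp

/-- Word version of "Jacobi and avoids 213". -/
def JGood : List ℕ → Prop
  | [] => True
  | a :: t => Even (t.takeWhile (fun x => decide (a < x))).length ∧
      t.Pairwise (fun b d => ¬ (b < a ∧ a < d)) ∧ JGood t

theorem JGood_append (L S : List ℕ) (h : ∀ x ∈ L, ∀ y ∈ S, y < x) :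
    JGood (L ++ S) ↔ JGood L ∧ JGood S := by
  induction L with
  | nil => simp [JGood]
  | cons a t ih =>
    have ih' := ih (fun x hx y hy => h x (by simp [hx]) y hy)
    have hS : ∀ y ∈ S, y < a := fun y hy => h a (by simp) y hy
    have h1 : (t ++ S).takeWhile (fun x => decide (a < x))
        = t.takeWhile (fun x => decide (a < x)) := by
      have h0 : S.takeWhile (fun x => decide (a < x)) = [] := by
        cases S with
        | nil => rfl
        | cons y S =>
          have := hS y (by simp)
          rw [List.takeWhile_cons_of_neg]
          simp; omega
      rw [List.takeWhile_append, h0]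
      split_ifs with h2
      · rw [List.append_nil]
        exact ((List.takeWhile_prefix _).eq_of_length h2).symm
      · rfl
    have h2 : (t ++ S).Pairwise (fun b d => ¬ (b < a ∧ a < d)) ↔
        t.Pairwise (fun b d => ¬ (b < a ∧ a < d)) := by
      rw [List.pairwise_append]
      constructor
      · exact fun h => h.1
      · intro h
        refine ⟨h, ?_, ?_⟩
        · rw [List.pairwise_iff_forall_sublist]
          intro x y hs
          have := hS y (hs.subset (by simp))
          omega
        · intro x hx y hy
          have := hS y hy
          omega
    simp only [List.cons_append, JGood, h1, h2, ih']
    tauto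

/-- `l` is an arrangement of the interval `[c, c+m)`. -/
def JInt (c m : ℕ) (l : List ℕ) : Prop := l.Nodup ∧ ∀ x, x ∈ l ↔ c ≤ x ∧ x < c + m

theorem JInt_iff (c m : ℕ) (l : List ℕ) : JInt c m l ↔ l.Perm (List.range' c m) := by
  constructor
  · rintro ⟨h1, h2⟩
    rw [List.perm_ext_iff_of_nodup h1 List.nodup_range']
    intro x
    rw [h2, List.mem_range'_1]
  · intro h
    refine ⟨h.nodup_iff.2 List.nodup_range', fun x => ?_⟩
    rw [h.mem_iff, List.mem_range'_1]

theorem JInt.length {c m : ℕ} {l : List ℕ} (h : JInt c m l) : l.length = m := by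
  rw [JInt_iff] at h
  simpa using h.length_eq

open Classical in
noncomputable def JW (c m : ℕ) : Finset (List ℕ) :=
  ((List.range' c m).permutations.toFinset).filter JGood

theorem mem_JW (c m : ℕ) (l : List ℕ) : l ∈ JW c m ↔ JInt c m l ∧ JGood l := by
  simp [JW, JInt_iff]

theorem JW_zero (c : ℕ) : JW c 0 = {[]} := by
  ext l
  rw [mem_JW, JInt_iff]
  simp only [List.range'_zero, List.perm_nil, Finset.mem_singleton]
  constructor
  · exact fun h => h.1
  · rintro rfl
    exact ⟨rfl, trivial⟩

theorem mem_JW_succ (c m : ℕ) (l : List ℕ) :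
    l ∈ JW c (m + 1) ↔ ∃ r, r ≤ m ∧ Even r ∧ ∃ L ∈ JW (c + (m - r) + 1) r,
      ∃ S ∈ JW c (m - r), l = (c + (m - r)) :: (L ++ S) := by
  constructor
  · rw [mem_JW]
    rintro ⟨hI, hG⟩
    cases l with
    | nil => exact absurd hI.length (by simp)
    | cons a t =>
      obtain ⟨hn, hm⟩ := hI
      obtain ⟨hev, hpw, hgt⟩ := hG
      rw [List.nodup_cons] at hn
      obtain ⟨hat, hnt⟩ := hn
      have hts : t.takeWhile (fun x => decide (a < x)) ++ t.dropWhile (fun x => decide (a < x))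
        = t := List.takeWhile_append_dropWhile
      have hL : ∀ x ∈ t.takeWhile (fun x => decide (a < x)), a < x := by
        intro x hx
        simpa using List.mem_takeWhile_imp hx
      have hS : ∀ x ∈ t.dropWhile (fun x => decide (a < x)), x < a := by
        have hpS := hpw.sublist (List.dropWhile_sublist (fun x => decide (a < x)))
        have hh : ∀ h : t.dropWhile (fun x => decide (a < x)) ≠ [],
            ¬ a < (t.dropWhile (fun x => decide (a < x))).head h := by
          intro h
          have := List.head_dropWhile_not (fun x => decide (a < x)) h
          simpa using this
        have hsub : ∀ x ∈ t.dropWhile (fun x => decide (a < x)), x ∈ t :=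
          fun x hx => (List.dropWhile_sublist _).subset hx
        clear hts
        generalize t.dropWhile (fun x => decide (a < x)) = S at hpS hh hsub ⊢
        cases S with
        | nil => simp
        | cons y S =>
          have h1 : ¬ a < y := hh (by simp)
          have h2 : y ≠ a := fun e => hat (e ▸ hsub y (by simp))
          rw [List.pairwise_cons] at hpS
          intro x hx
          rcases List.mem_cons.1 hx with rfl | hx'
          · omega
          · have h3 := hpS.1 x hx'
            have h4 : x ≠ a := fun e => hat (e ▸ hsub x hx)
            omega
      generalize t.takeWhile (fun x => decide (a < x)) = L at *
      generalize t.dropWhile (fun x => decide (a < x)) = S at *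
      subst hts
      have ha := (hm a).1 (by simp)
      rw [List.nodup_append] at hnt
      rw [JGood_append _ _ (fun x hx y hy => (hS y hy).trans (hL x hx))] at hgt
      have iL : JInt (a + 1) (c + m - a) L := by
        refine ⟨hnt.1, fun x => ⟨fun hx => ?_, fun hx => ?_⟩⟩
        · have h1 := (hm x).1 (by simp [hx])
          have h2 := hL x hx
          omega
        · have h1 := (hm x).2 (by omega)
          simp only [List.mem_cons, List.mem_append] at h1
          rcases h1 with h1 | h1 | h1
          · omega
          · exact h1
          · have := hS x h1
            omega
      have iS : JInt c (a - c) S := by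
        refine ⟨hnt.2.1, fun x => ⟨fun hx => ?_, fun hx => ?_⟩⟩
        · have h1 := (hm x).1 (by simp [hx])
          have h2 := hS x hx
          omega
        · have h1 := (hm x).2 (by omega)
          simp only [List.mem_cons, List.mem_append] at h1
          rcases h1 with h1 | h1 | h1
          · omega
          · have := hL x h1
            omega
          · exact h1
      have hlen := iL.length
      rw [hlen] at hev
      refine ⟨c + m - a, by omega, hev, L, ?_, S, ?_, ?_⟩
      · rw [show c + (m - (c + m - a)) + 1 = a + 1 by omega, mem_JW]
        exact ⟨iL, hgt.1⟩
      · rw [show m - (c + m - a) = a - c by omega, mem_JW]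
        exact ⟨iS, hgt.2⟩
      · congr 1
        omega
  · rintro ⟨r, hr, hev, L, hL, S, hS, rfl⟩
    rw [mem_JW] at *
    obtain ⟨iL, gL⟩ := hL
    obtain ⟨iS, gS⟩ := hS
    have hlen := iL.length
    obtain ⟨nL, mL⟩ := iL
    obtain ⟨nS, mS⟩ := iS
    refine ⟨⟨?_, ?_⟩, ?_, ?_, ?_⟩
    · rw [List.nodup_cons, List.nodup_append, List.mem_append, mL, mS]
      refine ⟨by omega, nL, nS, ?_⟩
      intro x hx y hy
      rw [mL] at hx
      rw [mS] at hy
      omega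
    · intro x
      rw [List.mem_cons, List.mem_append, mL, mS]
      omega
    · have h1 : (L ++ S).takeWhile (fun x => decide (c + (m - r) < x)) = L := by
        rw [List.takeWhile_append_of_pos]
        · have h0 : S.takeWhile (fun x => decide (c + (m - r) < x)) = [] := by
            cases S with
            | nil => rfl
            | cons y S =>
              have := (mS y).1 (by simp)
              rw [List.takeWhile_cons_of_neg]
              simp; omega
          rw [h0, List.append_nil]
        · intro x hx
          have := (mL x).1 hx
          simp; omega
      rw [h1, hlen]
      exact hev
    · rw [List.pairwise_append]
      refine ⟨?_, ?_, ?_⟩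
      · rw [List.pairwise_iff_forall_sublist]
        intro x y hs
        have := (mL x).1 (hs.subset (by simp))
        omega
      · rw [List.pairwise_iff_forall_sublist]
        intro x y hs
        have := (mS y).1 (hs.subset (by simp))
        omega
      · intro x hx y hy
        have := (mS y).1 hy
        omega
    · rw [JGood_append]
      · exact ⟨gL, gS⟩
      · intro x hx y hy
        rw [mL] at hx
        rw [mS] at hy
        omega

/-- Words in `JW c m` with last letter `k`. -/
noncomputable def JV (c m k : ℕ) : Finset (List ℕ) :=
  (JW c m).filter (fun l => l.getLast? = some k)

theorem mem_JV (c m k : ℕ) (l : List ℕ) :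
    l ∈ JV c m k ↔ l ∈ JW c m ∧ l.getLast? = some k := by
  simp [JV]

theorem JV_zero (c k : ℕ) : JV c 0 k = ∅ := by
  ext l
  rw [mem_JV, JW_zero]
  simp only [Finset.mem_singleton, Finset.notMem_empty, iff_false]
  rintro ⟨rfl, h⟩
  simp at h

theorem JV_lt (c m k : ℕ) (h : k < c) : JV c m k = ∅ := by
  ext l
  rw [mem_JV, mem_JW]
  simp only [Finset.notMem_empty, iff_false]
  rintro ⟨⟨h1, -⟩, h2⟩
  have := (h1.2 k).1 (List.mem_of_getLast? h2)
  omega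

/-- The block of `JW c (m+1)` with prescribed sizes. -/
noncomputable def JB (c m r : ℕ) : Finset (List ℕ) :=
  Finset.image₂ (fun L S => (c + (m - r)) :: (L ++ S)) (JW (c + (m - r) + 1) r) (JW c (m - r))

theorem JB_inj (c m r : ℕ) (A B : Finset (List ℕ)) (hA : A ⊆ JW (c + (m - r) + 1) r) :
    (Finset.image₂ (fun L S => (c + (m - r)) :: (L ++ S)) A B).card = A.card * B.card := by
  rw [Finset.card_image₂_iff]
  rintro ⟨L, S⟩ h ⟨L', S'⟩ h' he
  simp only [Finset.coe_product, Set.mem_prod, Finset.mem_coe] at h h'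
  have h1 := ((mem_JW _ _ _).1 (hA h.1)).1.length
  have h2 := ((mem_JW _ _ _).1 (hA h'.1)).1.length
  have h3 := List.append_inj (List.cons.inj he).2 (h1.trans h2.symm)
  exact Prod.ext h3.1 h3.2

theorem JW_succ (c m : ℕ) :
    JW c (m + 1) = ((Finset.range (m + 1)).filter Even).biUnion (JB c m) := by
  ext l
  rw [mem_JW_succ]
  simp only [Finset.mem_biUnion, Finset.mem_filter, Finset.mem_range, JB, Finset.mem_image₂]
  constructor
  · rintro ⟨r, h1, h2, L, hL, S, hS, rfl⟩
    exact ⟨r, ⟨by omega, h2⟩, L, hL, S, hS, rfl⟩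
  · rintro ⟨r, ⟨h1, h2⟩, L, hL, S, hS, rfl⟩
    exact ⟨r, by omega, h2, L, hL, S, hS, rfl⟩

theorem JB_disj (c m r r' : ℕ) (h : r ≤ m) (h' : r' ≤ m) (hne : r ≠ r') :
    Disjoint (JB c m r) (JB c m r') := by
  rw [Finset.disjoint_left]
  intro l hl hl'
  simp only [JB, Finset.mem_image₂] at hl hl'
  obtain ⟨L, -, S, -, rfl⟩ := hl
  obtain ⟨L', -, S', -, he⟩ := hl'
  have := (List.cons.inj he).1
  omega

theorem card_JW_succ (c m : ℕ) : (JW c (m + 1)).card = ∑ r ∈ Finset.range (m + 1),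
    if Even r then (JW (c + (m - r) + 1) r).card * (JW c (m - r)).card else 0 := by
  rw [JW_succ, Finset.card_biUnion, Finset.sum_filter]
  · refine Finset.sum_congr rfl fun r _ => ?_
    rw [JB, JB_inj _ _ _ _ _ (Finset.Subset.refl _)]
  · intro r hr r' hr' hne
    simp only [Finset.coe_filter, Set.mem_ofPred_eq, Finset.mem_range, Finset.mem_filter] at hr hr'
    exact JB_disj c m r r' (by omega) (by omega) hne

theorem card_JB_last (c m r k : ℕ) (hr : r ≤ m) :
    ((JB c m r).filter (fun l => l.getLast? = some k)).card =
      (JW (c + (m - r) + 1) r).card * (JV c (m - r) k).card +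
      if r = m then (if m = 0 then (if k = c then 1 else 0) else (JV (c + 1) m k).card) else 0 := by
  rcases Nat.lt_or_ge r m with h | h
  · rw [if_neg (by omega), add_zero, ← JB_inj _ _ _ _ _ (Finset.Subset.refl _)]
    congr 1
    ext l
    simp only [JB, Finset.mem_filter, Finset.mem_image₂]
    have key : ∀ L S, S ∈ JW c (m - r) →
        ((c + (m - r)) :: (L ++ S)).getLast? = S.getLast? := by
      intro L S hS
      have := ((mem_JW _ _ _).1 hS).1.length
      have hne : S ≠ [] := by
        rintro rfl
        simp at this
        omega
      rw [← List.cons_append, List.getLast?_append_of_ne_nil _ hne]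
    constructor
    · rintro ⟨⟨L, hL, S, hS, rfl⟩, h2⟩
      rw [key L S hS] at h2
      exact ⟨L, hL, S, (mem_JV _ _ _ _).2 ⟨hS, h2⟩, rfl⟩
    · rintro ⟨L, hL, S, hS, rfl⟩
      rw [mem_JV] at hS
      exact ⟨⟨L, hL, S, hS.1, rfl⟩, by rw [key L S hS.1]; exact hS.2⟩
  · obtain rfl : r = m := by omega
    simp only [Nat.sub_self, JV_zero, Finset.card_empty, mul_zero, zero_add, if_true, JB, JW_zero,
      add_zero, Finset.image₂_singleton_right, List.append_nil]
    split_ifs with h1 h2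
    · subst h1 h2
      rw [JW_zero, Finset.image_singleton, Finset.filter_singleton, if_pos (by simp)]
      simp
    · subst h1
      rw [JW_zero]
      simp only [Finset.image_singleton, Finset.card_eq_zero]
      rw [Finset.filter_eq_empty_iff]
      intro x hx
      rw [Finset.mem_singleton] at hx
      subst hx
      simp only [List.getLast?_singleton, Option.some.injEq]
      exact fun e => h2 e.symm
    · rw [Finset.filter_image, Finset.card_image_of_injective _ (List.cons_injective)]
      congr 1
      ext l
      rw [Finset.mem_filter, mem_JV]
      refine and_congr_right fun hl => ?_
      have := ((mem_JW _ _ _).1 hl).1.length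
      cases l with
      | nil => simp at this; omega
      | cons x l => rw [List.getLast?_cons_cons]

theorem card_JV_succ (c m k : ℕ) : (JV c (m + 1) k).card = (∑ r ∈ Finset.range (m + 1),
    if Even r then (JW (c + (m - r) + 1) r).card * (JV c (m - r) k).card else 0) +
    if Even m then (if m = 0 then (if k = c then 1 else 0) else (JV (c + 1) m k).card) else 0 := by
  have h0 : JV c (m + 1) k = ((Finset.range (m + 1)).filter Even).biUnion
      (fun r => (JB c m r).filter (fun l => l.getLast? = some k)) := by
    rw [← Finset.filter_biUnion, ← JW_succ]
    ext l
    rw [mem_JV, Finset.mem_filter]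
  rw [h0, Finset.card_biUnion]
  · have h1 : ∀ r ∈ (Finset.range (m + 1)).filter Even, _ := fun r hr =>
      card_JB_last c m r k (by
        simp only [Finset.mem_range, Finset.mem_filter] at hr
        omega)
    rw [Finset.sum_congr rfl h1, Finset.sum_add_distrib, Finset.sum_filter]
    congr 1
    rw [Finset.sum_ite_eq']
    simp
  · intro r hr r' hr' hne
    simp only [Finset.coe_filter, Set.mem_ofPred_eq, Finset.mem_range, Finset.mem_filter] at hr hr'
    exact Finset.disjoint_filter_filter (JB_disj c m r r' (by omega) (by omega) hne)

theorem card_JW_shift (m : ℕ) : ∀ c, (JW c m).card = (JW 0 m).card := by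
  induction m using Nat.strong_induction_on with
  | _ m ih =>
    intro c
    cases m with
    | zero => simp [JW_zero]
    | succ m =>
      rw [card_JW_succ, card_JW_succ]
      refine Finset.sum_congr rfl fun r hr => ?_
      rw [Finset.mem_range] at hr
      rw [ih r hr, ih (m - r) (by omega) c, ih r hr (0 + (m - r) + 1)]

theorem card_JV_shift (m : ℕ) : ∀ c k, (JV c m (c + k)).card = (JV 0 m k).card := by
  induction m using Nat.strong_induction_on with
  | _ m ih =>
    intro c k
    cases m with
    | zero => simp [JV_zero]
    | succ m =>
      rw [card_JV_succ, card_JV_succ]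
      congr 1
      · refine Finset.sum_congr rfl fun r hr => ?_
        rw [Finset.mem_range] at hr
        rw [card_JW_shift, ih (m - r) (by omega) c, card_JW_shift r (0 + (m - r) + 1)]
      · cases k with
        | zero =>
          rw [JV_lt _ _ _ (show c + 0 < c + 1 by omega), JV_lt _ _ _ (show 0 < 0 + 1 by omega)]
          simp
        | succ k =>
          rw [show c + (k + 1) = (c + 1) + k by ring, ih m (by omega),
            show k + 1 = (0 + 1) + k by ring, ih m (by omega), if_neg (show ¬ c + 1 + k = c by omega)]
          simp

noncomputable def Jw (m : ℕ) : ℕ := (JW 0 m).card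
noncomputable def Jv (m k : ℕ) : ℕ := (JV 0 m k).card

theorem Jw_succ (m : ℕ) : Jw (m + 1) =
    ∑ r ∈ Finset.range (m + 1), if Even r then Jw r * Jw (m - r) else 0 := by
  rw [Jw, card_JW_succ]
  refine Finset.sum_congr rfl fun r hr => ?_
  rw [card_JW_shift, Jw, Jw]

theorem Jv_succ_zero (m : ℕ) : Jv (m + 1) 0 =
    (∑ r ∈ Finset.range (m + 1), if Even r then Jw r * Jv (m - r) 0 else 0) +
      if m = 0 then 1 else 0 := by
  rw [Jv, card_JV_succ, JV_lt _ _ _ (show 0 < 0 + 1 by omega)]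
  congr 1
  · refine Finset.sum_congr rfl fun r hr => ?_
    rw [card_JW_shift, Jw, Jv]
  · by_cases h : m = 0 <;> simp [h]

theorem Jv_succ_succ (m k : ℕ) : Jv (m + 1) (k + 1) =
    (∑ r ∈ Finset.range (m + 1), if Even r then Jw r * Jv (m - r) (k + 1) else 0) +
      if Even m then Jv m k else 0 := by
  rw [Jv, card_JV_succ, show k + 1 = (0 + 1) + k by ring, card_JV_shift m (0 + 1) k]
  congr 1
  · refine Finset.sum_congr rfl fun r hr => ?_
    rw [card_JW_shift, Jw, Jv]
  · by_cases h : m = 0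
    · subst h
      simp [Jv, JV_zero]
    · simp [h, Jv]

open PowerSeries

noncomputable def JE : ℚ⟦X⟧ := PowerSeries.mk fun n => (Jw (2 * n) : ℚ)
noncomputable def JO : ℚ⟦X⟧ := PowerSeries.mk fun n => (Jw (2 * n + 1) : ℚ)
noncomputable def JF (k : ℕ) : ℚ⟦X⟧ := PowerSeries.mk fun n => (Jv (2 * n) k : ℚ)
noncomputable def JG (k : ℕ) : ℚ⟦X⟧ := PowerSeries.mk fun n => (Jv (2 * n + 1) k : ℚ)

theorem J_conv_even (n : ℕ) (f : ℕ → ℕ) :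
    ((∑ r ∈ Finset.range (2 * n + 1), if Even r then Jw r * f (2 * n - r) else 0 : ℕ) : ℚ)
      = coeff n (JE * PowerSeries.mk fun n => (f (2 * n) : ℚ)) := by
  rw [J_sum_even n (fun r => Jw r * f (2 * n - r)), coeff_mul,
    Finset.Nat.sum_antidiagonal_eq_sum_range_succ_mk]
  push_cast
  refine Finset.sum_congr rfl fun i hi => ?_
  simp [JE, Nat.mul_sub]

theorem J_conv_odd (n : ℕ) (f : ℕ → ℕ) :
    ((∑ r ∈ Finset.range (2 * n + 1 + 1), if Even r then Jw r * f (2 * n + 1 - r) else 0 : ℕ) : ℚ)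
      = coeff n (JE * PowerSeries.mk fun n => (f (2 * n + 1) : ℚ)) := by
  rw [J_sum_odd n (fun r => Jw r * f (2 * n + 1 - r)), coeff_mul,
    Finset.Nat.sum_antidiagonal_eq_sum_range_succ_mk]
  push_cast
  refine Finset.sum_congr rfl fun i hi => ?_
  rw [Finset.mem_range] at hi
  simp only [JE, coeff_mk]
  rw [show 2 * n + 1 - 2 * i = 2 * (n - i) + 1 by omega]

theorem JO_eq : JO = JE * JE := by
  ext n
  rw [JO, coeff_mk, Jw_succ, J_conv_even]
  rfl

theorem JE_eq : JE = 1 + X * (JE * JO) := by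
  ext n
  cases n with
  | zero => simp [JE, Jw, JW_zero]
  | succ n =>
    rw [map_add, coeff_succ_X_mul, JE, coeff_mk, show 2 * (n + 1) = 2 * n + 1 + 1 by ring,
      Jw_succ, J_conv_odd]
    simp [JE, JO, coeff_one]

theorem JF_eq (k : ℕ) : JF k = X * (JE * JG k) := by
  ext n
  cases n with
  | zero => simp [JF, Jv, JV_zero]
  | succ n =>
    rw [coeff_succ_X_mul, JF, coeff_mk, show 2 * (n + 1) = 2 * n + 1 + 1 by ring]
    cases k with
    | zero =>
      rw [Jv_succ_zero, if_neg (by omega), add_zero, J_conv_odd _ (fun m => Jv m 0)]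
      rfl
    | succ k =>
      rw [Jv_succ_succ, if_neg (by simp), add_zero, J_conv_odd _ (fun m => Jv m (k + 1))]
      rfl

theorem JG_zero : JG 0 = JE * JF 0 + 1 := by
  ext n
  rw [JG, coeff_mk, Jv_succ_zero, Nat.cast_add, J_conv_even _ (fun m => Jv m 0), map_add, coeff_one]
  simp [JF]

theorem JG_succ (k : ℕ) : JG (k + 1) = JE * JF (k + 1) + JF k := by
  ext n
  rw [JG, coeff_mk, Jv_succ_succ, Nat.cast_add, J_conv_even _ (fun m => Jv m (k + 1)), map_add]
  simp [JF]

theorem JE_cubic : JE = 1 + X * JE ^ 3 := by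
  conv_lhs => rw [JE_eq, JO_eq]
  ring

theorem JG_formula (k : ℕ) : JG k = X ^ k * JE ^ (2 * k + 1) := by
  have h1 : JE * (1 - X * JE ^ 2) = 1 := by
    linear_combination JE_cubic
  induction k with
  | zero =>
    have h2 := JG_zero
    rw [JF_eq] at h2
    linear_combination (-JG 0) * h1 + JE * h2
  | succ k ih =>
    have h2 := JG_succ k
    rw [JF_eq, JF_eq, ih] at h2
    linear_combination (-JG (k + 1)) * h1 + JE * h2

theorem JF_formula (k : ℕ) : JF k = X ^ (k + 1) * JE ^ (2 * k + 2) := by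
  rw [JF_eq, JG_formula]
  ring

theorem JE_coeff (j : ℕ) : ∀ p : ℕ,
    ((3 * j + p : ℕ) : ℚ) * coeff j (JE ^ p) = p * ((3 * j + p).choose j : ℕ) := by
  have hc0 : coeff 0 JE = 1 := by simp [JE, Jw, JW_zero]
  induction j with
  | zero =>
    intro p
    have : constantCoeff JE = 1 := by simpa using hc0
    simp [this]
  | succ j ih =>
    intro p
    induction p with
    | zero => simp
    | succ p ihp =>
      have hrec : coeff (j + 1) (JE ^ (p + 1)) = coeff (j + 1) (JE ^ p) + coeff j (JE ^ (p + 3)) := by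
        have : JE ^ (p + 1) = JE ^ p + X * JE ^ (p + 3) := by
          linear_combination JE ^ p * JE_cubic
        rw [this, map_add, coeff_succ_X_mul]
      have ih3 := ih (p + 3)
      rw [hrec]
      generalize coeff (j + 1) (JE ^ p) = u at *
      generalize coeff j (JE ^ (p + 3)) = v at *
      rw [show 3 * j + (p + 3) = 3 * j + p + 3 by ring] at ih3
      rw [show 3 * (j + 1) + p = 3 * j + p + 3 by ring] at ihp
      rw [show 3 * (j + 1) + (p + 1) = (3 * j + p + 3) + 1 by ring, Nat.choose_succ_succ]
      have hch := Nat.choose_succ_right_eq (3 * j + p + 3) j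
      rw [show 3 * j + p + 3 - j = 2 * j + p + 3 by omega] at hch
      have hch' : (((3 * j + p + 3).choose (j + 1) : ℕ) : ℚ) * (j + 1)
        = ((3 * j + p + 3).choose j : ℕ) * (2 * j + p + 3) := by exact_mod_cast hch
      push_cast at *
      generalize (((3 * j + p + 3).choose (j + 1) : ℕ) : ℚ) = x' at *
      generalize (((3 * j + p + 3).choose j : ℕ) : ℚ) = x at *
      have hN : (3 * (j : ℚ) + p + 3) ≠ 0 := by positivity
      apply mul_left_cancel₀ hN
      linear_combination (3 * (j : ℚ) + p + 3 + 1) * (ihp + ih3) - 3 * hch'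

/-- Function version of rho length. -/
noncomputable def Jrho {m : ℕ} (g : Fin m → ℕ) (k : Fin m) : ℕ :=
  Nat.card {j : Fin m // k < j ∧ ∀ i : Fin m, k < i → i ≤ j → g k < g i}

theorem J_card_succ {m : ℕ} (Q : Fin (m + 1) → Prop) [Decidable (Q 0)] :
    Nat.card {j : Fin (m + 1) // Q j} =
      (if Q 0 then 1 else 0) + Nat.card {j : Fin m // Q j.succ} := by
  classical
  rw [Nat.card_eq_fintype_card, Nat.card_eq_fintype_card, Fintype.card_subtype,
    Fintype.card_subtype, Fin.card_filter_univ_succ]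
  split_ifs <;> simp [Function.comp_def, add_comm]

theorem J_card_takeWhile (a : ℕ) {m : ℕ} (h : Fin m → ℕ) :
    Nat.card {j : Fin m // ∀ i : Fin m, i ≤ j → a < h i} =
      ((List.ofFn h).takeWhile (fun x => decide (a < x))).length := by
  induction m with
  | zero => simp
  | succ m ih =>
    classical
    rw [J_card_succ, List.ofFn_succ]
    by_cases h0 : a < h 0
    · rw [List.takeWhile_cons_of_pos (by simpa using h0), List.length_cons, ← ih, if_pos, add_comm]
      · simp [Fin.forall_fin_succ, h0]
      · intro i hi
        rw [Fin.le_zero_iff] at hi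
        rwa [hi]
    · rw [List.takeWhile_cons_of_neg (by simpa using h0), if_neg]
      · simp [Fin.forall_fin_succ, h0]
      · exact fun hh => h0 (hh 0 le_rfl)

theorem Jrho_zero {m : ℕ} (g : Fin (m + 1) → ℕ) : Jrho g 0 =
    ((List.ofFn fun i : Fin m => g i.succ).takeWhile (fun x => decide (g 0 < x))).length := by
  classical
  rw [Jrho, J_card_succ, ← J_card_takeWhile]
  simp [Fin.forall_fin_succ]

theorem Jrho_succ {m : ℕ} (g : Fin (m + 1) → ℕ) (k : Fin m) : Jrho g k.succ =
    Jrho (fun i : Fin m => g i.succ) k := by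
  classical
  rw [Jrho, J_card_succ, Jrho]
  simp [Fin.forall_fin_succ]

theorem JGood_ofFn {m : ℕ} (g : Fin m → ℕ) : JGood (List.ofFn g) ↔
    (∀ k, Even (Jrho g k)) ∧
      ¬ ∃ i j k : Fin m, i < j ∧ j < k ∧ g j < g i ∧ g i < g k := by
  induction m with
  | zero => simp [JGood]
  | succ m ih =>
    rw [List.ofFn_succ, JGood, ih, Fin.forall_fin_succ, Jrho_zero, List.pairwise_ofFn]
    simp only [Jrho_succ]
    have h2 : (¬ ∃ i j k : Fin (m + 1), i < j ∧ j < k ∧ g j < g i ∧ g i < g k) ↔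
        (∀ ⦃i j : Fin m⦄, i < j → ¬ (g i.succ < g 0 ∧ g 0 < g j.succ)) ∧
        ¬ ∃ i j k : Fin m, i < j ∧ j < k ∧ g j.succ < g i.succ ∧ g i.succ < g k.succ := by
      constructor
      · intro h
        refine ⟨fun i j hij hh => h ⟨0, i.succ, j.succ, Fin.succ_pos _, by simpa using hij, hh⟩, ?_⟩
        rintro ⟨i, j, k, hij, hjk, hh⟩
        exact h ⟨i.succ, j.succ, k.succ, by simpa using hij, by simpa using hjk, hh⟩
      · rintro ⟨h1, h2⟩ ⟨i, j, k, hij, hjk, hh⟩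
        obtain ⟨j, rfl⟩ := Fin.exists_succ_eq.2 (Fin.ne_zero_of_lt hij)
        obtain ⟨k, rfl⟩ := Fin.exists_succ_eq.2 (Fin.ne_zero_of_lt hjk)
        rw [Fin.succ_lt_succ_iff] at hjk
        induction i using Fin.cases with
        | zero => exact h1 hjk hh
        | succ i => exact h2 ⟨i, j, k, by simpa using hij, hjk, hh⟩
    rw [h2]
    tauto

theorem JInt_ofFn {m : ℕ} (π : Equiv.Perm (Fin m)) : JInt 0 m (List.ofFn fun i => (π i : ℕ)) := by
  refine ⟨List.nodup_ofFn.2 (Fin.val_injective.comp π.injective), fun x => ?_⟩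
  rw [List.mem_ofFn]
  constructor
  · rintro ⟨i, rfl⟩
    simp
  · rintro ⟨-, h⟩
    exact ⟨π.symm ⟨x, by omega⟩, by simp⟩

theorem J_exists_perm {m : ℕ} (l : List ℕ) (h : JInt 0 m l) :
    ∃ π : Equiv.Perm (Fin m), (List.ofFn fun i => (π i : ℕ)) = l := by
  have hl := h.length
  obtain ⟨hn, hm⟩ := h
  subst hl
  have hlt : ∀ i : Fin l.length, l.get i < l.length := fun i => by
    have := (hm (l.get i)).1 (List.get_mem l i)
    omega
  have hinj : Function.Injective (fun i : Fin l.length => (⟨l.get i, hlt i⟩ : Fin l.length)) := by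
    intro i j hij
    exact List.nodup_iff_injective_get.1 hn (Fin.mk.inj hij)
  refine ⟨Equiv.ofBijective _ (Finite.injective_iff_bijective.1 hinj), ?_⟩
  exact List.ofFn_get l

theorem J_good_perm {m : ℕ} (π : Equiv.Perm (Fin m)) :
    JGood (List.ofFn fun i => (π i : ℕ)) ↔ IsJacobi π ∧ Avoids213 π := by
  rw [JGood_ofFn]
  rfl

theorem J_last_perm {m : ℕ} (π : Equiv.Perm (Fin (m + 1))) (k : ℕ) :
    (List.ofFn fun i => (π i : ℕ)).getLast? = some k ↔ lastVal π = k + 1 := by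
  rw [List.getLast?_eq_getElem?, lastVal, dif_pos (Nat.succ_pos m), List.length_ofFn,
    List.getElem?_eq_getElem (by simp), List.getElem_ofFn]
  simp

theorem J_count (m k : ℕ) :
    Nat.card {π : Equiv.Perm (Fin (m + 1)) // IsJacobi π ∧ Avoids213 π ∧ lastVal π = k + 1}
      = Jv (m + 1) k := by
  have hmem : ∀ π : Equiv.Perm (Fin (m + 1)), (IsJacobi π ∧ Avoids213 π ∧ lastVal π = k + 1) ↔
      (List.ofFn fun i => (π i : ℕ)) ∈ JV 0 (m + 1) k := by
    intro π
    rw [mem_JV, mem_JW, J_good_perm, J_last_perm]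
    have := JInt_ofFn π
    tauto
  have h1 : Jv (m + 1) k = Nat.card {l // l ∈ JV 0 (m + 1) k} := by
    rw [Nat.card_eq_fintype_card, Fintype.card_coe, Jv]
  rw [h1]
  refine Nat.card_eq_of_bijective
    (fun π => ⟨List.ofFn fun i => (π.1 i : ℕ), (hmem π.1).1 π.2⟩) ⟨?_, ?_⟩
  · intro π σ h
    have h2 := List.ofFn_injective (Subtype.mk.inj h)
    apply Subtype.ext
    ext i
    exact congrFun h2 i
  · rintro ⟨l, hl⟩
    obtain ⟨π, rfl⟩ := J_exists_perm l ((mem_JW _ _ _).1 ((mem_JV _ _ _ _).1 hl).1).1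
    exact ⟨⟨π, (hmem π).2 hl⟩, rfl⟩

/-- Counting 213-avoiding Jacobi permutations by the last letter. -/
theorem jacobi_avoid_213_last (n k : ℕ) (hk : 1 ≤ k) (hkn : k ≤ n) :
    (Nat.card {π : Equiv.Perm (Fin (2 * n)) //
        IsJacobi π ∧ Avoids213 π ∧ lastVal π = k} : ℚ)
      = (2 * (k : ℚ) / ((3 * n - k : ℕ) : ℚ)) * ((3 * n - k).choose (2 * n) : ℕ) ∧
    (Nat.card {π : Equiv.Perm (Fin (2 * n - 1)) //
        IsJacobi π ∧ Avoids213 π ∧ lastVal π = k} : ℚ)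
      = ((2 * (k : ℚ) - 1) / ((3 * n - k - 1 : ℕ) : ℚ))
          * ((3 * n - k - 1).choose (2 * n - 1) : ℕ) := by
  obtain ⟨k, rfl⟩ : ∃ k', k = k' + 1 := ⟨k - 1, by omega⟩
  obtain ⟨j, rfl⟩ : ∃ j, n = k + 1 + j := ⟨n - (k + 1), by omega⟩
  constructor
  · have h1 := J_count (2 * (k + j) + 1) k
    rw [show 2 * (k + 1 + j) = 2 * (k + j) + 1 + 1 by ring, h1]
    have h2 : (Jv (2 * (k + j) + 1 + 1) k : ℚ) = coeff (k + 1 + j) (JF k) := by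
      rw [JF, coeff_mk]
      congr 2
      ring
    rw [h2, JF_formula, add_comm (k + 1) j, coeff_X_pow_mul]
    have h3 := JE_coeff j (2 * k + 2)
    rw [show 3 * (j + (k + 1)) - (k + 1) = 3 * j + (2 * k + 2) by omega,
      Nat.choose_symm_of_eq_add (show 3 * j + (2 * k + 2) = (2 * (k + j) + 1 + 1) + j by ring)]
    have hN : ((3 * j + (2 * k + 2) : ℕ) : ℚ) ≠ 0 := by positivity
    rw [div_mul_eq_mul_div, eq_div_iff hN, mul_comm, h3]
    push_cast
    ring
  · have h1 := J_count (2 * (k + j)) k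
    rw [show 2 * (k + 1 + j) - 1 = 2 * (k + j) + 1 by omega, h1]
    have h2 : (Jv (2 * (k + j) + 1) k : ℚ) = coeff (j + k) (JG k) := by
      rw [JG, coeff_mk, add_comm j k]
    rw [h2, JG_formula, coeff_X_pow_mul]
    have h3 := JE_coeff j (2 * k + 1)
    rw [show 3 * (k + 1 + j) - (k + 1) - 1 = 3 * j + (2 * k + 1) by omega,
      Nat.choose_symm_of_eq_add (show 3 * j + (2 * k + 1) = (2 * (k + j) + 1) + j by ring)]
    have hN : ((3 * j + (2 * k + 1) : ℕ) : ℚ) ≠ 0 := by positivity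
    rw [div_mul_eq_mul_div, eq_div_iff hN, mul_comm, h3]
    push_cast
    ring
end

section
/- For all n ≥ 1 and k ≥ 1: the number of Jacobi permutations π of [2n] avoiding 231 with last letter π_{2n} = k equals Σ_{m=0}^{n−1} ((n+k−3m−1)/(n+k−1))·C(n−m−1, k−2m−1)·C(n+k−1, m), and the number of Jacobi permutations π of [2n+1] avoiding 231 with last letter π_{2n+1} = k equals Σ_{m=0}^{n−1} ((n+k−3m−1)/(n+k−1))·C(n−m, k−2m−1)·C(n+k−1, m). (Here C(a,b) = 0 whenever b < 0 or b > a.) -/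
/-- The binomial coefficient `C(a,b)` for integers, with `C(a,b) = 0` whenever
`b < 0` or `b > a`. -/
def intChoose (a b : ℤ) : ℤ :=
  if 0 ≤ b ∧ b ≤ a then (a.toNat.choose b.toNat : ℤ) else 0

namespace JacAux

def Jac : List ℕ → Prop
  | [] => True
  | x :: l => Even (l.takeWhile (fun y => decide (x < y))).length ∧ Jac l

def Av : List ℕ → Prop
  | [] => True
  | x :: l => l.Pairwise (fun b c => ¬ (c < x ∧ x < b)) ∧ Av l

theorem Jac_map (a : ℕ) (l : List ℕ) : Jac (l.map (a + ·)) ↔ Jac l := by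
  induction l with
  | nil => simp [Jac]
  | cons x l ih =>
    simp only [List.map_cons, Jac, ih, List.takeWhile_map, List.length_map]
    have : ((fun y => decide (a + x < y)) ∘ fun x => a + x) = fun y => decide (x < y) := by
      funext y; simp
    rw [this]

theorem Av_map (a : ℕ) (l : List ℕ) : Av (l.map (a + ·)) ↔ Av l := by
  induction l with
  | nil => simp [Av]
  | cons x l ih =>
    simp only [List.map_cons, Av, ih, List.pairwise_map]
    simp

theorem Jac_append (α γ : List ℕ) (h : ∀ x ∈ α, ∀ y ∈ γ, x < y) :
    Jac (α ++ γ) ↔ Jac α ∧ Jac γ ∧ (α = [] ∨ Even γ.length) := by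
  induction α with
  | nil => simp [Jac]
  | cons x α ih =>
    have ih := ih (fun z hz => h z (by simp [hz]))
    have hx : γ.takeWhile (fun y => decide (x < y)) = γ := by
      rw [List.takeWhile_eq_self_iff]
      intro y hy
      simpa using h x (by simp) y hy
    simp only [List.cons_append, Jac, ih, List.takeWhile_append, hx]
    by_cases hα : α = []
    · subst hα
      simp [Jac]
      tauto
    · simp only [hα, false_or]
      split_ifs with hc
      · rw [List.length_append, hc, Nat.even_add]
        simp
        tauto
      · simp; tauto

theorem Jac_big (N : ℕ) (β : List ℕ) (h : ∀ y ∈ β, y < N) : Jac (N :: β) ↔ Jac β := by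
  have : β.takeWhile (fun y => decide (N < y)) = [] := by
    cases β with
    | nil => rfl
    | cons y l => 
      have := h y (by simp)
      rw [List.takeWhile_cons]; simp; omega
  simp [Jac, this]

theorem Av_append (N : ℕ) (α β : List ℕ) (hα : ∀ y ∈ α, y < N) (hβ : ∀ y ∈ β, y < N) :
    Av (α ++ N :: β) ↔ Av α ∧ Av β ∧ ∀ x ∈ α, ∀ y ∈ β, x ≤ y := by
  induction α with
  | nil =>
    simp only [List.nil_append, Av]
    have : β.Pairwise (fun b c => ¬ (c < N ∧ N < b)) := by
      apply List.Pairwise.imp_of_mem (R := fun _ _ => True)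
      · intro a b ha hb _ 
        have := hβ a ha
        omega
      · exact List.pairwise_of_forall (fun _ _ => trivial)
    exact ⟨fun h => ⟨trivial, h.2, by simp⟩, fun h => ⟨this, h.2.1⟩⟩
  | cons x α ih =>
    have ih := ih (fun z hz => hα z (by simp [hz]))
    have hx := hα x (by simp)
    simp only [List.cons_append, Av, ih, List.pairwise_append, List.pairwise_cons, List.mem_cons]
    constructor
    · rintro ⟨⟨h1, ⟨h2, h3⟩, h4⟩, h5, h6, h7⟩
      refine ⟨⟨h1, h5⟩, h6, ?_⟩
      rintro z (rfl | hz) y hy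
      · have := h2 y hy; omega
      · exact h7 z hz y hy
    · rintro ⟨⟨h1, h5⟩, h6, h7⟩
      refine ⟨⟨h1, ⟨?_, ?_⟩, ?_⟩, h5, h6, fun z hz => h7 z (Or.inr hz)⟩
      · intro y hy; have := h7 x (Or.inl rfl) y hy; omega
      · apply List.Pairwise.imp_of_mem (R := fun _ _ => True)
        · intro a b ha hb _ 
          have := h7 x (Or.inl rfl) b hb
          omega
        · exact List.pairwise_of_forall (fun _ _ => trivial)
      · rintro z hz y (rfl | hy)
        · omega
        · have := h7 x (Or.inl rfl) y hy; omega

open Classical in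
noncomputable def G (N : ℕ) : Finset (List ℕ) :=
  (List.range N).permutations.toFinset.filter (fun l => Jac l ∧ Av l)

theorem mem_G {N : ℕ} {l : List ℕ} :
    l ∈ G N ↔ l.Perm (List.range N) ∧ Jac l ∧ Av l := by
  simp [G]

theorem G_zero : G 0 = {[]} := by
  ext l
  simp only [mem_G, Finset.mem_singleton, List.range_zero, List.perm_nil]
  constructor
  · exact fun h => h.1
  · rintro rfl; simp [Jac, Av]

theorem perm_split (N : ℕ) (α β : List ℕ) (h : (α ++ N :: β).Perm (List.range (N+1)))
    (hle : ∀ x ∈ α, ∀ y ∈ β, x ≤ y) :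
    ∃ β' : List ℕ, β = β'.map (α.length + ·) ∧ α.Perm (List.range α.length) ∧
      β'.Perm (List.range β'.length) ∧ α.length + β'.length = N := by
  have h1 : (α ++ β).Perm (List.range N) := by
    have h2 : (N :: (α ++ β)).Perm (N :: List.range N) := by
      refine (List.perm_middle.symm.trans h).trans ?_
      rw [List.range_succ]
      exact List.perm_append_comm.trans (by simp)
    exact (List.perm_cons N).1 h2
  have hnd : (α ++ β).Nodup := h1.nodup_iff.2 List.nodup_range
  have hlen : α.length + β.length = N := by simpa using h1.length_eq
  rw [List.nodup_append] at hnd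
  obtain ⟨na, nb, nab⟩ := hnd
  have hα : α.Perm (List.range α.length) := by
    apply List.Subperm.perm_of_length_le
    · apply List.subperm_of_subset na
      intro x hx
      rw [List.mem_range]
      have hs : List.range (x+1) ⊆ α := by
        intro z hz
        rw [List.mem_range] at hz
        have hxN : x ∈ List.range N := h1.subset (by simp [hx])
        rw [List.mem_range] at hxN
        have : z ∈ α ++ β := h1.symm.subset (by rw [List.mem_range]; omega)
        rw [List.mem_append] at this
        rcases this with h | h
        · exact h
        · have a1 := hle x hx z h
          have a2 := nab x hx z h
          omega
      have := (List.subperm_of_subset List.nodup_range hs).length_le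
      simp at this
      omega
    · simp
  have hβ : β.Perm ((List.range β.length).map (α.length + ·)) := by
    have : (α ++ β).Perm (List.range α.length ++ (List.range β.length).map (α.length + ·)) := by
      rw [← List.range_add, hlen]; exact h1
    exact (List.perm_append_left_iff _).1 ((hα.append_right β).symm.trans this)
  refine ⟨β.map (· - α.length), ?_, hα, ?_, by simpa using hlen⟩
  · rw [List.map_map]
    conv_lhs => rw [← List.map_id β]
    apply List.map_congr_left
    intro y hy
    have := hβ.subset hy
    simp only [List.mem_map] at this
    obtain ⟨z, _, rfl⟩ := this
    simp
  · have := hβ.map (· - α.length)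
    rw [List.map_map] at this
    simpa [Function.comp_def] using this

theorem mem_G_succ {N : ℕ} {l : List ℕ} : l ∈ G (N+1) ↔ ∃ a b α β, a + b = N ∧ (a = 0 ∨ Odd b) ∧
    α ∈ G a ∧ β ∈ G b ∧ α ++ N :: β.map (a + ·) = l := by
  constructor
  · intro h
    rw [mem_G] at h
    obtain ⟨hp, hj, hv⟩ := h
    have hN : N ∈ l := hp.symm.subset (by simp)
    obtain ⟨α, β, rfl⟩ := List.append_of_mem hN
    have hnd : (α ++ N :: β).Nodup := hp.nodup_iff.2 List.nodup_range
    have hlt : ∀ y ∈ α ++ β, y < N := by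
      intro y hy
      have h1 : y ∈ List.range (N+1) := hp.subset (by simp at hy ⊢; tauto)
      rw [List.mem_range] at h1
      have h2 := List.nodup_middle.1 hnd
      rw [List.nodup_cons] at h2
      have : y ≠ N := fun h => h2.1 (h ▸ hy)
      omega
    have hα : ∀ y ∈ α, y < N := fun y hy => hlt y (by simp [hy])
    have hβ : ∀ y ∈ β, y < N := fun y hy => hlt y (by simp [hy])
    rw [Av_append N α β hα hβ] at hv
    obtain ⟨v1, v2, v3⟩ := hv
    obtain ⟨β', rfl, p1, p2, p3⟩ := perm_split N α β hp v3
    have hnd2 := List.nodup_append.1 hnd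
    rw [Jac_append, Jac_big _ _ hβ, Jac_map] at hj
    · obtain ⟨j1, j2, j3⟩ := hj
      rw [Av_map] at v2
      refine ⟨α.length, β'.length, α, β', p3, ?_, mem_G.2 ⟨p1, j1, v1⟩, mem_G.2 ⟨p2, j2, v2⟩, rfl⟩
      simpa [Nat.even_add_one] using j3
    · intro x hx y hy
      rw [List.mem_cons] at hy
      rcases hy with rfl | hy
      · exact hα x hx
      · exact lt_of_le_of_ne (v3 x hx y hy) (hnd2.2.2 x hx y (by simp [hy]))
  · rintro ⟨a, b, α, β, hab, hc, hα, hβ, rfl⟩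
    rw [mem_G] at hα hβ ⊢
    obtain ⟨pa, ja, va⟩ := hα
    obtain ⟨pb, jb, vb⟩ := hβ
    have la : α.length = a := by simpa using pa.length_eq
    have lb : β.length = b := by simpa using pb.length_eq
    have ma : ∀ y ∈ α, y < a := fun y hy => by simpa using pa.subset hy
    have mb : ∀ y ∈ β, y < b := fun y hy => by simpa using pb.subset hy
    have ma' : ∀ y ∈ α, y < N := fun y hy => by have := ma y hy; omega
    have mb' : ∀ y ∈ β.map (a + ·), a ≤ y ∧ y < N := by
      intro y hy
      rw [List.mem_map] at hy
      obtain ⟨z, hz, rfl⟩ := hy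
      have := mb z hz
      omega
    refine ⟨?_, ?_, ?_⟩
    · refine List.perm_middle.trans ?_
      rw [List.range_succ]
      refine List.Perm.trans ?_ List.perm_append_comm
      simp only [List.singleton_append, List.perm_cons]
      rw [← hab, List.range_add]
      exact pa.append (pb.map _)
    · rw [Jac_append, Jac_big _ _ (fun y hy => (mb' y hy).2), Jac_map]
      · refine ⟨ja, jb, ?_⟩
        rcases hc with rfl | hc
        · left; exact List.length_eq_zero_iff.1 la
        · right; simpa [Nat.even_add_one, lb] using hc
      · intro x hx y hy
        rw [List.mem_cons] at hy
        rcases hy with rfl | hy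
        · exact ma' x hx
        · have := mb' y hy; have := ma x hx; omega
    · rw [Av_append N _ _ ma' (fun y hy => (mb' y hy).2), Av_map]
      refine ⟨va, vb, fun x hx y hy => ?_⟩
      have := mb' y hy; have := ma x hx; omega

theorem G_sum {M : Type*} [AddCommMonoid M] (f : List ℕ → M) (N : ℕ) :
    ∑ l ∈ G (N+1), f l = ∑ p ∈ (Finset.HasAntidiagonal.antidiagonal N).filter (fun p => p.1 = 0 ∨ Odd p.2),
      ∑ α ∈ G p.1, ∑ β ∈ G p.2, f (α ++ N :: β.map (p.1 + ·)) := by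
  simp_rw [← Finset.sum_product']
  rw [Finset.sum_sigma']
  symm
  refine Finset.sum_bij (fun q _ => q.2.1 ++ N :: q.2.2.map (q.1.1 + ·)) ?_ ?_ ?_ ?_
  · rintro ⟨⟨a, b⟩, ⟨α, β⟩⟩ h
    simp only [Finset.mem_sigma, Finset.mem_filter, Finset.HasAntidiagonal.mem_antidiagonal,
      Finset.mem_product] at h
    exact mem_G_succ.2 ⟨a, b, α, β, h.1.1, h.1.2, h.2.1, h.2.2, rfl⟩
  · rintro ⟨⟨a, b⟩, ⟨α, β⟩⟩ h ⟨⟨a', b'⟩, ⟨α', β'⟩⟩ h' heq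
    simp only [Finset.mem_sigma, Finset.mem_filter, Finset.HasAntidiagonal.mem_antidiagonal,
      Finset.mem_product] at h h' heq
    obtain ⟨⟨h1, h2⟩, h3, h4⟩ := h
    obtain ⟨⟨h1', h2'⟩, h3', h4'⟩ := h'
    have nn : ∀ {a b : ℕ} {α : List ℕ}, a + b = N → α ∈ G a → N ∉ α ∧ α.length = a := by
      intro a b α hab hα
      have := (mem_G.1 hα).1
      refine ⟨fun h => ?_, by simpa using this.length_eq⟩
      have := this.subset h
      simp at this
      omega
    have n1 := nn h1 h3
    have n2 := nn h1' h3'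
    have key : α = α' ∧ β.map (a + ·) = β'.map (a' + ·) := by
      have t1 := congrArg (List.takeWhile (fun y => decide (y ≠ N))) heq
      have aux : ∀ (α β : List ℕ), N ∉ α →
          List.takeWhile (fun y => decide (y ≠ N)) (α ++ N :: β) = α := by
        intro α β h
        rw [List.takeWhile_append_of_pos]
        · simp
        · intro z hz; simp; rintro rfl; exact h hz
      rw [aux _ _ n1.1, aux _ _ n2.1] at t1
      subst t1
      simpa using heq
    obtain ⟨rfl, hb⟩ := key
    obtain rfl : a = a' := n1.2.symm.trans n2.2
    obtain rfl : b = b' := by omega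
    have : β = β' := List.map_injective_iff.2 (add_right_injective a) hb
    subst this
    rfl
  · intro l hl
    obtain ⟨a, b, α, β, h1, h2, h3, h4, h5⟩ := mem_G_succ.1 hl
    refine ⟨⟨(a, b), (α, β)⟩, ?_, h5⟩
    simp only [Finset.mem_sigma, Finset.mem_filter, Finset.HasAntidiagonal.mem_antidiagonal,
      Finset.mem_product]
    exact ⟨⟨h1, h2⟩, h3, h4⟩
  · intro q hq; rfl

open PowerSeries in
theorem pow_coeff (e : PowerSeries ℚ) (he : e = 1 + X * e ^ 3) (m : ℕ) : ∀ r : ℕ,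
    coeff m (e ^ r) = if m = 0 then 1 else (r : ℚ) / (3 * m + r) * (3 * m + r).choose m := by
  induction m with
  | zero =>
    intro r
    have : constantCoeff e = 1 := by
      rw [he]; simp
    simp [this]
  | succ m ihm =>
    intro r
    induction r with
    | zero => simp [coeff_one]
    | succ r ihr =>
      have h1 : e ^ (r + 1) = e ^ r + X * e ^ (r + 3) := by
        rw [pow_succ]
        nth_rewrite 2 [he]
        ring
      rw [h1, map_add, ihr, coeff_succ_X_mul, ihm]
      have hT : (if m = 0 then (1:ℚ) else ((r + 3 : ℕ) : ℚ) / (3 * m + (r + 3 : ℕ)) * (3 * m + (r + 3)).choose m)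
        = ((r + 3 : ℕ) : ℚ) / (3 * m + (r + 3 : ℕ)) * (3 * m + (r + 3)).choose m := by
        split_ifs with h
        · subst h
          have : ((r:ℚ) + 3) ≠ 0 := by positivity
          simp [this]
        · rfl
      rw [hT]
      simp only [Nat.succ_ne_zero, if_false]
      have e1 : 3 * (m + 1) + (r + 1) = (3 * m + (r + 3)) + 1 := by ring
      have e2 : 3 * (m + 1) + r = 3 * m + (r + 3) := by ring
      rw [e1, e2, Nat.choose_succ_succ]
      have h3 : ((3 * m + (r + 3)).choose (m+1) : ℚ) * (m + 1) = (3 * m + (r + 3)).choose m * (2 * m + r + 3) := by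
        have := Nat.choose_succ_right_eq (3 * m + (r + 3)) m
        have h4 : 3 * m + (r + 3) - m = 2 * m + r + 3 := by omega
        rw [h4] at this
        exact_mod_cast this
      push_cast
      generalize ((3 * m + (r + 3)).choose (m+1) : ℚ) = x at *
      generalize ((3 * m + (r + 3)).choose m : ℚ) = y at *
      have d1 : (3 * ((m:ℚ)+1) + r) ≠ 0 := by positivity
      have d2 : (3 * (m:ℚ) + (r + 3)) ≠ 0 := by positivity
      have d3 : (3 * ((m:ℚ)+1) + (r+1)) ≠ 0 := by positivity
      have hx : x = y * (2 * m + r + 3) / (m + 1) := by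
        field_simp; linarith
      rw [hx]
      have d4 : (m : ℚ) + 1 ≠ 0 := by positivity
      field_simp
      ring

noncomputable def wt (l : List ℕ) : Polynomial ℚ :=
  match l.getLast? with
  | none => 0
  | some k => Polynomial.X ^ k

noncomputable def A (N : ℕ) : ℚ := ∑ _l ∈ G N, 1
noncomputable def W (N : ℕ) : Polynomial ℚ := ∑ l ∈ G N, wt l

theorem wt_app (N a : ℕ) (α β : List ℕ) (hβ : β ≠ []) :
    wt (α ++ N :: β.map (a + ·)) = Polynomial.X ^ a * wt β := by
  unfold wt
  have : (α ++ N :: β.map (a + ·)).getLast? = (β.getLast?).map (a + ·) := by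
    rw [List.getLast?_append_of_ne_nil _ (by simp), List.getLast?_cons, List.getLast?_map]
    rw [List.getLast?_eq_getLast_of_ne_nil hβ]
    simp
  rw [this]
  rw [List.getLast?_eq_getLast_of_ne_nil hβ]
  simp [pow_add]

theorem A_zero : A 0 = 1 := by simp [A, G_zero]
theorem W_zero : W 0 = 0 := by simp [W, G_zero, wt]

theorem A_succ (N : ℕ) : A (N+1) =
    ∑ p ∈ (Finset.HasAntidiagonal.antidiagonal N).filter (fun p => p.1 = 0 ∨ Odd p.2),
      A p.1 * A p.2 := by
  unfold A
  rw [G_sum]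
  apply Finset.sum_congr rfl
  intro p _
  rw [Finset.sum_mul_sum]
  simp

theorem W_one : W 1 = 1 := by
  unfold W
  rw [G_sum]
  simp [Finset.filter_singleton, G_zero, wt]

theorem W_succ (N : ℕ) (hN : N ≠ 0) : W (N+1) =
    ∑ p ∈ (Finset.HasAntidiagonal.antidiagonal N).filter (fun p => p.1 = 0 ∨ Odd p.2),
      (Polynomial.C (A p.1) * Polynomial.X ^ p.1) * W p.2 := by
  unfold W A
  rw [G_sum]
  apply Finset.sum_congr rfl
  rintro ⟨a, b⟩ hp
  simp only [Finset.mem_filter, Finset.HasAntidiagonal.mem_antidiagonal] at hp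
  rw [map_sum, mul_assoc, Finset.sum_mul]
  apply Finset.sum_congr rfl
  intro α _
  rw [map_one, one_mul, Finset.mul_sum]
  apply Finset.sum_congr rfl
  intro β hβ
  apply wt_app
  rintro rfl
  have := (mem_G.1 hβ).1.length_eq
  simp at this
  subst this
  rcases hp.2 with h | h
  · omega
  · simp at h

theorem sum_odd {M : Type*} [AddCommMonoid M] (f : ℕ → ℕ → M) (n : ℕ) :
    ∑ p ∈ (Finset.HasAntidiagonal.antidiagonal (2*n+1)).filter (fun p => p.1 = 0 ∨ Odd p.2), f p.1 p.2
      = ∑ p ∈ Finset.HasAntidiagonal.antidiagonal n, f (2 * p.1) (2 * p.2 + 1) := by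
  symm
  refine Finset.sum_bij (fun p _ => (2 * p.1, 2 * p.2 + 1)) ?_ ?_ ?_ ?_
  · rintro ⟨a, b⟩ h
    simp only [Finset.mem_filter, Finset.HasAntidiagonal.mem_antidiagonal] at h ⊢
    exact ⟨by omega, Or.inr (by simp)⟩
  · rintro ⟨a, b⟩ _ ⟨c, d⟩ _ h
    simp only [Prod.mk.injEq] at h ⊢
    omega
  · rintro ⟨a, b⟩ h
    simp only [Finset.mem_filter, Finset.HasAntidiagonal.mem_antidiagonal, Nat.odd_iff] at h
    refine ⟨(a / 2, b / 2), ?_, ?_⟩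
    · simp only [Finset.HasAntidiagonal.mem_antidiagonal]; omega
    · simp only [Prod.mk.injEq]; omega
  · intros; rfl

theorem sum_even {M : Type*} [AddCommMonoid M] (f : ℕ → ℕ → M) (n : ℕ) :
    ∑ p ∈ (Finset.HasAntidiagonal.antidiagonal (2*n+2)).filter (fun p => p.1 = 0 ∨ Odd p.2), f p.1 p.2
      = f 0 (2 * n + 2) +
        ∑ p ∈ Finset.HasAntidiagonal.antidiagonal n, f (2 * p.1 + 1) (2 * p.2 + 1) := by
  have hm : ((0, 2*n+2) : ℕ × ℕ) ∈
      (Finset.HasAntidiagonal.antidiagonal (2*n+2)).filter (fun p => p.1 = 0 ∨ Odd p.2) := by simp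
  rw [← Finset.add_sum_erase _ _ hm]
  congr 1
  symm
  refine Finset.sum_bij (fun p _ => (2 * p.1 + 1, 2 * p.2 + 1)) ?_ ?_ ?_ ?_
  · rintro ⟨a, b⟩ h
    simp only [Finset.mem_erase, Finset.mem_filter, Finset.HasAntidiagonal.mem_antidiagonal] at h ⊢
    exact ⟨by simp, by omega, Or.inr (by simp)⟩
  · rintro ⟨a, b⟩ _ ⟨c, d⟩ _ h
    simp only [Prod.mk.injEq] at h ⊢
    omega
  · rintro ⟨a, b⟩ h
    simp only [Finset.mem_erase, Finset.mem_filter, Finset.HasAntidiagonal.mem_antidiagonal,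
      Nat.odd_iff, ne_eq, Prod.mk.injEq] at h
    refine ⟨(a / 2, b / 2), ?_, ?_⟩
    · simp only [Finset.HasAntidiagonal.mem_antidiagonal]; omega
    · simp only [Prod.mk.injEq]; omega
  · intros; rfl

open PowerSeries

noncomputable def se : PowerSeries ℚ := PowerSeries.mk fun n => A (2 * n)
noncomputable def so : PowerSeries ℚ := PowerSeries.mk fun n => A (2 * n + 1)

theorem se_eq : se = 1 + X * (se * so) := by
  ext n
  cases n with
  | zero => simp [se, A_zero]
  | succ n =>
    rw [map_add, coeff_succ_X_mul, coeff_mul]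
    simp only [se, so, coeff_mk, coeff_one, Nat.succ_ne_zero, if_false, zero_add]
    rw [show 2 * (n+1) = (2 * n + 1) + 1 by ring, A_succ, sum_odd (fun a b => A a * A b)]

theorem so_eq : so = se + X * (so * so) := by
  ext n
  cases n with
  | zero =>
    simp only [se, so, map_add, coeff_mk, coeff_zero_X_mul, add_zero]
    rw [A_succ]
    simp [Finset.filter_singleton, A_zero]
  | succ n =>
    rw [map_add, coeff_succ_X_mul, coeff_mul]
    simp only [se, so, coeff_mk]
    rw [show 2 * (n+1) = 2 * n + 2 by ring, A_succ, sum_even (fun a b => A a * A b), A_zero, one_mul]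

theorem so_sq : so = se ^ 2 := by
  have h1 := se_eq
  have h2 := so_eq
  have h3 : (1 - X * so) * (so - se ^ 2) = 0 := by
    linear_combination h2 - se * h1
  rcases mul_eq_zero.1 h3 with h | h
  · have := congrArg (constantCoeff (R := ℚ)) h
    simp at this
  · exact sub_eq_zero.1 h

theorem se_cubic : se = 1 + X * se ^ 3 := by
  have := se_eq
  rw [so_sq] at this
  linear_combination this

noncomputable def lift (f : PowerSeries ℚ) : PowerSeries (Polynomial ℚ) :=
  PowerSeries.rescale ((Polynomial.X : Polynomial ℚ) ^ 2) (PowerSeries.map Polynomial.C f)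

noncomputable def SE : PowerSeries (Polynomial ℚ) := lift se
noncomputable def Le : PowerSeries (Polynomial ℚ) := PowerSeries.mk fun n => W (2 * n + 2)
noncomputable def Lo : PowerSeries (Polynomial ℚ) := PowerSeries.mk fun n => W (2 * n + 1)

theorem coeff_lift (f : PowerSeries ℚ) (n : ℕ) :
    coeff n (lift f) = Polynomial.X ^ (2 * n) * Polynomial.C (coeff n f) := by
  simp [lift, coeff_rescale, pow_mul]

theorem coeff_SE_pow (r m : ℕ) : coeff m (SE ^ r) =
    Polynomial.X ^ (2 * m) * Polynomial.C (coeff m (se ^ r)) := by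
  rw [← coeff_lift]
  simp [SE, lift]

theorem Le_eq : Le = SE * Lo := by
  ext1 n
  rw [coeff_mul]
  simp only [Le, Lo, coeff_mk, SE, coeff_lift, se]
  rw [W_succ _ (by omega), sum_odd (fun a b => (Polynomial.C (A a) * Polynomial.X ^ a) * W b)]
  apply Finset.sum_congr rfl
  intro p _
  ring

theorem Lo_eq : Lo = 1 + X * (Le + C (Polynomial.X) * SE ^ 2 * Lo) := by
  have hS : SE ^ 2 = lift so := by rw [so_sq]; simp [SE, lift]
  ext1 n
  cases n with
  | zero => simp [Lo, W_one]
  | succ n =>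
    rw [map_add, coeff_succ_X_mul, map_add, mul_assoc, coeff_C_mul, coeff_mul, hS]
    simp only [Le, Lo, coeff_mk, coeff_lift, so, coeff_one, Nat.succ_ne_zero, if_false, zero_add]
    rw [W_succ _ (by omega), show 2 * (n+1) = 2 * n + 2 by ring,
      sum_even (fun a b => (Polynomial.C (A a) * Polynomial.X ^ a) * W b), A_zero, Finset.mul_sum]
    congr 1
    · simp
    · apply Finset.sum_congr rfl
      intro p _
      ring

noncomputable def Q : PowerSeries (Polynomial ℚ) := SE * (1 + C (Polynomial.X) * SE)

theorem Lo_Q : Lo = 1 + X * Q * Lo := by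
  have := Lo_eq
  rw [Le_eq] at this
  unfold Q
  linear_combination this

theorem Lo_iter (n : ℕ) : Lo = ∑ j ∈ Finset.range n, (X * Q) ^ j + (X * Q) ^ n * Lo := by
  induction n with
  | zero => simp
  | succ n ih =>
    rw [Finset.sum_range_succ]
    have := Lo_Q
    linear_combination ih + (X * Q)^n * this

theorem coeff_SE_Q (s j m k : ℕ) :
    (coeff m (SE ^ s * Q ^ j)).coeff k = if 2 * m ≤ k then
      (j.choose (k - 2 * m) : ℚ) * coeff m (se ^ (s + j + (k - 2 * m))) else 0 := by
  have h : SE ^ s * Q ^ j = ∑ i ∈ Finset.range (j+1), C (Polynomial.X ^ i * (j.choose i : Polynomial ℚ)) * SE ^ (s + j + i) := by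
    unfold Q
    rw [mul_pow, add_comm, add_pow, Finset.mul_sum, Finset.mul_sum]
    apply Finset.sum_congr rfl
    intro i _
    simp only [map_mul, map_pow, map_natCast, one_pow]
    ring
  rw [h, map_sum, Polynomial.finsetSum_coeff]
  have h2 : ∀ i, (coeff m (C (Polynomial.X ^ i * (j.choose i : Polynomial ℚ)) * SE ^ (s + j + i))).coeff k
      = if i + 2 * m = k then (j.choose i : ℚ) * coeff m (se ^ (s + j + i)) else 0 := by
    intro i
    rw [coeff_C_mul, coeff_SE_pow]
    have : Polynomial.X ^ i * (j.choose i : Polynomial ℚ) * (Polynomial.X ^ (2 * m) * Polynomial.C (coeff m (se ^ (s + j + i))))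
      = Polynomial.C ((j.choose i : ℚ) * coeff m (se ^ (s + j + i))) * Polynomial.X ^ (i + 2 * m) := by
      rw [map_mul, map_natCast]
      ring
    rw [this, Polynomial.coeff_C_mul_X_pow]
    simp only [eq_comm]
  simp_rw [h2]
  split_ifs with hk
  · rw [Finset.sum_eq_single (k - 2 * m)]
    · rw [if_pos (by omega)]
    · intro b _ hb
      rw [if_neg (by omega)]
    · intro hb
      rw [Finset.mem_range] at hb
      rw [Nat.choose_eq_zero_of_lt (by omega)]
      simp
  · apply Finset.sum_eq_zero
    intro i _
    rw [if_neg (by omega)]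

theorem coeff_main (s n k : ℕ) :
    (coeff n (SE ^ s * Lo)).coeff k = ∑ m ∈ Finset.range (n + 1), if 2 * m ≤ k then
      ((n - m).choose (k - 2 * m) : ℚ) * coeff m (se ^ (s + (n - m) + (k - 2 * m))) else 0 := by
  have h : SE ^ s * Lo = ∑ j ∈ Finset.range (n+1), X ^ j * (SE ^ s * Q ^ j)
      + X ^ (n+1) * (SE ^ s * Q ^ (n+1) * Lo) := by
    conv_lhs => rw [Lo_iter (n+1)]
    rw [mul_add, Finset.mul_sum]
    refine congrArg₂ (· + ·) ?_ ?_
    · apply Finset.sum_congr rfl; intro i _; ring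
    · ring
  rw [h, map_add, coeff_X_pow_mul', if_neg (by omega), add_zero, map_sum,
    Polynomial.finsetSum_coeff, ← Finset.sum_range_reflect]
  apply Finset.sum_congr rfl
  intro m hm
  rw [Finset.mem_range] at hm
  have e1 : n + 1 - 1 - m = n - m := by omega
  rw [e1, coeff_X_pow_mul', if_pos (by omega), coeff_SE_Q]
  have e2 : n - (n - m) = m := by omega
  rw [e2]

theorem W_even (n k : ℕ) : (W (2 * n + 2)).coeff k = 
   ∑ m ∈ Finset.range (n + 1), if 2 * m ≤ k then
      ((n - m).choose (k - 2 * m) : ℚ) * coeff m (se ^ (1 + (n - m) + (k - 2 * m))) else 0 := by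
  rw [← coeff_main, pow_one, ← Le_eq, Le, coeff_mk]

theorem W_odd (n k : ℕ) : (W (2 * n + 1)).coeff k = 
   ∑ m ∈ Finset.range (n + 1), if 2 * m ≤ k then
      ((n - m).choose (k - 2 * m) : ℚ) * coeff m (se ^ (0 + (n - m) + (k - 2 * m))) else 0 := by
  rw [← coeff_main, pow_zero, one_mul, Lo, coeff_mk]

theorem se_pow_coeff (m r : ℕ) (h : 3 * m + r ≠ 0) :
    coeff m (se ^ r) = (r : ℚ) / (3 * m + r) * (3 * m + r).choose m := by
  rw [pow_coeff se se_cubic]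
  split_ifs with hm
  · subst hm
    have : (r : ℚ) ≠ 0 := by norm_cast; omega
    simp [this]
  · rfl

theorem W_even' (n k : ℕ) (hn : 1 ≤ n) (hk : 1 ≤ k) : (W (2 * n)).coeff (k - 1) =
    ∑ m ∈ Finset.range n,
          (((n : ℚ) + (k : ℚ) - 3 * (m : ℚ) - 1) / ((n : ℚ) + (k : ℚ) - 1))
            * (intChoose ((n : ℤ) - (m : ℤ) - 1) ((k : ℤ) - 2 * (m : ℤ) - 1) : ℤ)
            * (intChoose ((n : ℤ) + (k : ℤ) - 1) (m : ℤ) : ℤ) := by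
  obtain ⟨n, rfl⟩ := Nat.exists_eq_add_of_le' hn
  obtain ⟨k, rfl⟩ := Nat.exists_eq_add_of_le' hk
  rw [show 2 * (n+1) = 2 * n + 2 by ring, W_even]
  apply Finset.sum_congr rfl
  intro m hm
  rw [Finset.mem_range] at hm
  obtain ⟨j, rfl⟩ := Nat.exists_eq_add_of_le' (Nat.le_of_lt_succ hm)
  simp only [Nat.add_sub_cancel]
  split_ifs with h2
  · obtain ⟨i, rfl⟩ := Nat.exists_eq_add_of_le' h2
    rw [se_pow_coeff _ _ (by omega)]
    simp only [Nat.add_sub_cancel]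
    have c1 : intChoose (((j + m + 1 : ℕ) : ℤ) - (m : ℤ) - 1) (((i + 2 * m + 1 : ℕ) : ℤ) - 2 * (m : ℤ) - 1)
        = j.choose i := by
      rw [show (((j + m + 1 : ℕ) : ℤ) - (m : ℤ) - 1) = (j : ℤ) by push_cast; ring,
        show (((i + 2 * m + 1 : ℕ) : ℤ) - 2 * (m : ℤ) - 1) = (i : ℤ) by push_cast; ring]
      unfold intChoose
      split_ifs with h
      · simp
      · rw [Nat.choose_eq_zero_of_lt (by omega)]; simp
    have c2 : intChoose (((j + m + 1 : ℕ) : ℤ) + ((i + 2 * m + 1 : ℕ) : ℤ) - 1) (m : ℤ)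
        = (3 * m + (1 + j + i)).choose m := by
      rw [show (((j + m + 1 : ℕ) : ℤ) + ((i + 2 * m + 1 : ℕ) : ℤ) - 1) = ((3 * m + (1 + j + i) : ℕ) : ℤ) by push_cast; ring]
      unfold intChoose
      rw [if_pos (by omega), Int.toNat_natCast, Int.toNat_natCast]
    rw [c1, c2]
    push_cast
    ring_nf
  · rw [show intChoose (((j + m + 1 : ℕ) : ℤ) - (m : ℤ) - 1) (((k + 1 : ℕ) : ℤ) - 2 * (m : ℤ) - 1) = 0 from
      if_neg (by omega)]
    simp

theorem W_odd' (n k : ℕ) (hn : 1 ≤ n) (hk : 1 ≤ k) : (W (2 * n + 1)).coeff (k - 1) =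
    ∑ m ∈ Finset.range n,
          (((n : ℚ) + (k : ℚ) - 3 * (m : ℚ) - 1) / ((n : ℚ) + (k : ℚ) - 1))
            * (intChoose ((n : ℤ) - (m : ℤ)) ((k : ℤ) - 2 * (m : ℤ) - 1) : ℤ)
            * (intChoose ((n : ℤ) + (k : ℤ) - 1) (m : ℤ) : ℤ) := by
  obtain ⟨k, rfl⟩ := Nat.exists_eq_add_of_le' hk
  rw [W_odd, Finset.sum_range_succ]
  have hlast : (if 2 * n ≤ k + 1 - 1 then
      ((n - n).choose (k + 1 - 1 - 2 * n) : ℚ) * coeff n (se ^ (0 + (n - n) + (k + 1 - 1 - 2 * n))) else 0) = 0 := by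
    split_ifs with h
    · rw [se_pow_coeff _ _ (by omega)]
      rcases Nat.eq_zero_or_pos (k + 1 - 1 - 2 * n) with h0 | h0
      · rw [h0]; simp
      · rw [Nat.choose_eq_zero_of_lt (by omega)]; simp
    · rfl
  rw [hlast, add_zero]
  apply Finset.sum_congr rfl
  intro m hm
  rw [Finset.mem_range] at hm
  obtain ⟨j, rfl⟩ := Nat.exists_eq_add_of_le' hm.le
  simp only [Nat.add_sub_cancel]
  split_ifs with h2
  · obtain ⟨i, rfl⟩ := Nat.exists_eq_add_of_le' h2
    rw [se_pow_coeff _ _ (by omega)]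
    simp only [Nat.add_sub_cancel]
    have c1 : intChoose (((j + m : ℕ) : ℤ) - (m : ℤ)) (((i + 2 * m + 1 : ℕ) : ℤ) - 2 * (m : ℤ) - 1)
        = j.choose i := by
      rw [show (((j + m : ℕ) : ℤ) - (m : ℤ)) = (j : ℤ) by push_cast; ring,
        show (((i + 2 * m + 1 : ℕ) : ℤ) - 2 * (m : ℤ) - 1) = (i : ℤ) by push_cast; ring]
      unfold intChoose
      split_ifs with h
      · simp
      · rw [Nat.choose_eq_zero_of_lt (by omega)]; simp
    have c2 : intChoose (((j + m : ℕ) : ℤ) + ((i + 2 * m + 1 : ℕ) : ℤ) - 1) (m : ℤ)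
        = (3 * m + (0 + j + i)).choose m := by
      rw [show (((j + m : ℕ) : ℤ) + ((i + 2 * m + 1 : ℕ) : ℤ) - 1) = ((3 * m + (0 + j + i) : ℕ) : ℤ) by push_cast; ring]
      unfold intChoose
      rw [if_pos (by omega), Int.toNat_natCast, Int.toNat_natCast]
    rw [c1, c2]
    push_cast
    ring_nf
  · rw [show intChoose (((j + m : ℕ) : ℤ) - (m : ℤ)) (((k + 1 : ℕ) : ℤ) - 2 * (m : ℤ) - 1) = 0 from
      if_neg (by omega)]
    simp


theorem Jac_iff (l : List ℕ) : Jac l ↔ ∀ (i : ℕ) (hi : i < l.length),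
    Even ((l.drop (i+1)).takeWhile (fun y => decide (l[i] < y))).length := by
  induction l with
  | nil => simp [Jac]
  | cons x l ih =>
    rw [Jac, ih]
    constructor
    · rintro ⟨h1, h2⟩ i hi
      cases i with
      | zero => simpa using h1
      | succ i => simpa using h2 i (by simpa using hi)
    · intro h
      refine ⟨h 0 (by simp), fun i hi => ?_⟩
      exact h (i+1) (by simpa using hi)

theorem Av_iff (l : List ℕ) : Av l ↔ ∀ (i j k : ℕ) (hij : i < j) (hjk : j < k) (hk : k < l.length),
    ¬ (l[k] < l[i] ∧ l[i] < l[j]) := by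
  induction l with
  | nil => simp [Av]
  | cons x l ih =>
    rw [Av, ih, List.pairwise_iff_getElem]
    constructor
    · rintro ⟨h1, h2⟩ i j k hij hjk hk
      obtain ⟨j, rfl⟩ := Nat.exists_eq_add_of_le' (show 1 ≤ j by omega)
      obtain ⟨k, rfl⟩ := Nat.exists_eq_add_of_le' (show 1 ≤ k by omega)
      simp only [List.length_cons] at hk
      cases i with
      | zero => simpa using h1 j k (by omega) (by omega) (by omega)
      | succ i => simpa using h2 i j k (by omega) (by omega) (by omega)
    · intro h
      constructor
      · intro j k hj hk hjk
        exact h 0 (j+1) (k+1) (by omega) (by omega) (by simpa using hk)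
      · intro i j k hij hjk hk
        exact h (i+1) (j+1) (k+1) (by omega) (by omega) (by simpa using hk)

theorem lt_takeWhile (p : ℕ → Bool) (d : List ℕ) (j : ℕ) :
    j < (d.takeWhile p).length ↔ j < d.length ∧ ∀ (i : ℕ) (hi : i < d.length), i ≤ j → p d[i] := by
  induction d generalizing j with
  | nil => simp
  | cons x d ih =>
    rw [List.takeWhile_cons]
    by_cases hx : p x
    · simp only [hx, if_true, List.length_cons]
      cases j with
      | zero =>
        simp only [Nat.zero_lt_succ, true_and, true_iff]
        intro i hi h0
        obtain rfl : i = 0 := by omega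
        simpa using hx
      | succ j =>
        rw [Nat.add_lt_add_iff_right, ih, Nat.add_lt_add_iff_right]
        refine and_congr_right fun _ => ⟨fun h i hi hij => ?_, fun h i hi hij => ?_⟩
        · cases i with
          | zero => simpa using hx
          | succ i => simpa using h i (by omega) (by omega)
        · exact h (i+1) (by omega) (by omega)
    · simp only [hx]
      constructor
      · intro h; simp at h
      · rintro ⟨_, h⟩
        exact absurd (h 0 (by simp) (by omega)) (by simpa using hx)

def toL {n : ℕ} (π : Equiv.Perm (Fin n)) : List ℕ := List.ofFn (fun i => (π i : ℕ))

theorem rhoLen_eq {n : ℕ} (π : Equiv.Perm (Fin n)) (k : Fin n) :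
    rhoLen π k = (((toL π).drop (k+1)).takeWhile (fun y => decide ((π k : ℕ) < y))).length := by
  set L := (((toL π).drop (k+1)).takeWhile (fun y => decide ((π k : ℕ) < y))).length with hL
  have key : ∀ j : ℕ, j < L ↔ ∃ h : k + 1 + j < n,
      ∀ i : Fin n, k < i → i ≤ ⟨k + 1 + j, h⟩ → π k < π i := by
    intro j
    rw [hL, lt_takeWhile]
    have hk := k.2
    constructor
    · rintro ⟨h1, h2⟩
      simp only [List.length_drop, toL, List.length_ofFn] at h1
      refine ⟨by omega, fun i hi hij => ?_⟩
      have hi' : (k : ℕ) < i := hi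
      have hij' : (i : ℕ) ≤ k + 1 + j := hij
      have := h2 (i - (k + 1)) (by simp [toL]; omega) (by omega)
      simp only [toL, List.getElem_drop, List.getElem_ofFn, decide_eq_true_eq] at this
      have e : (⟨k + 1 + (i - (k+1)), by omega⟩ : Fin n) = i := Fin.ext (by simp; omega)
      rw [e] at this
      exact this
    · rintro ⟨h1, h2⟩
      refine ⟨by simp [toL]; omega, fun i hi hij => ?_⟩
      simp only [toL, List.getElem_drop, List.getElem_ofFn, decide_eq_true_eq]
      exact h2 ⟨k + 1 + i, by omega⟩ (Fin.lt_def.2 (by simp; omega)) (Fin.le_def.2 (by simp; omega))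
  unfold rhoLen
  rw [← Nat.card_fin L]
  symm
  refine Nat.card_eq_of_bijective (fun j : Fin L => ⟨⟨k + 1 + j, ((key j).1 j.2).1⟩,
    Fin.lt_def.2 (by simp; omega), ((key j).1 j.2).2⟩) ⟨?_, ?_⟩
  · intro a b h
    simp only [Subtype.mk.injEq, Fin.mk.injEq] at h
    exact Fin.ext (by omega)
  · rintro ⟨j, h1, h2⟩
    have h1' : (k : ℕ) < j := h1
    have e : (k : ℕ) + 1 + (j - (k + 1)) = j := by omega
    refine ⟨⟨j - (k+1), (key _).2 ⟨by omega, fun i hi hij => h2 i hi ?_⟩⟩, ?_⟩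
    · have : (i : ℕ) ≤ k + 1 + (j - (k+1)) := hij
      exact Fin.le_def.2 (by omega)
    · apply Subtype.ext
      exact Fin.ext e

theorem jac_toL {n : ℕ} (π : Equiv.Perm (Fin n)) : Jac (toL π) ↔ IsJacobi π := by
  rw [Jac_iff]
  unfold IsJacobi
  simp only [rhoLen_eq]
  constructor
  · intro h k
    simpa [toL] using h k (by simp [toL])
  · intro h i hi
    have hi' : i < n := by simpa [toL] using hi
    simpa [toL] using h ⟨i, hi'⟩

theorem av_toL {n : ℕ} (π : Equiv.Perm (Fin n)) : Av (toL π) ↔ Avoids231 π := by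
  rw [Av_iff]
  unfold Avoids231
  constructor
  · rintro h ⟨i, j, k, hij, hjk, h1, h2⟩
    have := h i j k hij hjk (by simp [toL])
    simp only [toL, List.getElem_ofFn] at this
    exact this ⟨h1, h2⟩
  · intro h i j k hij hjk hk
    have hk' : k < n := by simpa [toL] using hk
    simp only [toL, List.getElem_ofFn]
    rintro ⟨h1, h2⟩
    exact h ⟨⟨i, by omega⟩, ⟨j, by omega⟩, ⟨k, hk'⟩, hij, hjk, h1, h2⟩

theorem perm_toL {n : ℕ} (π : Equiv.Perm (Fin n)) : (toL π).Perm (List.range n) := by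
  apply List.Subperm.perm_of_length_le
  · apply List.subperm_of_subset
    · rw [toL, List.nodup_ofFn]
      exact Fin.val_injective.comp π.injective
    · intro x hx
      simp only [toL, List.mem_ofFn] at hx
      obtain ⟨i, rfl⟩ := hx
      simp
  · simp [toL]

theorem exists_toL {n : ℕ} (l : List ℕ) (hl : l.Perm (List.range n)) :
    ∃ π : Equiv.Perm (Fin n), toL π = l := by
  have hlen : l.length = n := by simpa using hl.length_eq
  have hnd : l.Nodup := hl.nodup_iff.2 List.nodup_range
  let f : Fin n → Fin n := fun i => ⟨l[i], by simpa using hl.subset (List.getElem_mem _)⟩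
  have hf : Function.Injective f := by
    intro a b h
    have h' : l[a] = l[b] := congrArg Fin.val h
    exact Fin.ext ((hnd.getElem_inj_iff).1 h')
  refine ⟨Equiv.ofBijective f (Finite.injective_iff_bijective.1 hf), ?_⟩
  apply List.ext_getElem
  · simp [toL, hlen]
  · intro i h1 h2
    simp [toL, f]

theorem last_toL {n : ℕ} (π : Equiv.Perm (Fin n)) (k : ℕ) (hn : 0 < n) (hk : 1 ≤ k) :
    lastVal π = k ↔ (toL π).getLast? = some (k - 1) := by
  have hne : toL π ≠ [] := by
    intro h
    have := congrArg List.length h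
    simp [toL] at this
    omega
  rw [List.getLast?_eq_getLast_of_ne_nil hne, List.getLast_eq_getElem]
  simp only [lastVal, hn, toL, dif_pos, List.getElem_ofFn, List.length_ofFn, Option.some.injEq]
  omega

theorem card_eq (N k : ℕ) (hN : 0 < N) (hk : 1 ≤ k) :
    (Nat.card {π : Equiv.Perm (Fin N) // IsJacobi π ∧ Avoids231 π ∧ lastVal π = k} : ℚ)
      = (W N).coeff (k - 1) := by
  have h1 : (W N).coeff (k - 1) = (((G N).filter (fun l => l.getLast? = some (k - 1))).card : ℚ) := by
    unfold W
    rw [Polynomial.finsetSum_coeff, Finset.card_filter, Nat.cast_sum]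
    apply Finset.sum_congr rfl
    intro l _
    unfold wt
    cases l.getLast? with
    | none => simp
    | some j => simp [Polynomial.coeff_X_pow, eq_comm]
  rw [h1]
  norm_cast
  rw [← Nat.card_eq_finsetCard]
  refine Nat.card_eq_of_bijective (fun π => ⟨toL π.1, ?_⟩) ⟨?_, ?_⟩
  · rw [Finset.mem_filter, mem_G, jac_toL, av_toL, ← last_toL _ _ hN hk]
    exact ⟨⟨perm_toL _, π.2.1, π.2.2.1⟩, π.2.2.2⟩
  · rintro ⟨a, _⟩ ⟨b, _⟩ h
    simp only [Subtype.mk.injEq, toL] at h ⊢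
    have := List.ofFn_injective h
    ext i
    exact congrFun this i
  · rintro ⟨l, hl⟩
    rw [Finset.mem_filter, mem_G] at hl
    obtain ⟨π, rfl⟩ := exists_toL l hl.1.1
    rw [jac_toL, av_toL, ← last_toL _ _ hN hk] at hl
    exact ⟨⟨π, hl.1.2.1, hl.1.2.2, hl.2⟩, rfl⟩

end JacAux

/-- Counting 231-avoiding Jacobi permutations by the last letter. -/
theorem jacobi_avoid_231_last (n k : ℕ) (hn : 1 ≤ n) (hk : 1 ≤ k) :
    (Nat.card {π : Equiv.Perm (Fin (2 * n)) //
        IsJacobi π ∧ Avoids231 π ∧ lastVal π = k} : ℚ)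
      = ∑ m ∈ Finset.range n,
          (((n : ℚ) + (k : ℚ) - 3 * (m : ℚ) - 1) / ((n : ℚ) + (k : ℚ) - 1))
            * (intChoose ((n : ℤ) - (m : ℤ) - 1) ((k : ℤ) - 2 * (m : ℤ) - 1) : ℤ)
            * (intChoose ((n : ℤ) + (k : ℤ) - 1) (m : ℤ) : ℤ) ∧
    (Nat.card {π : Equiv.Perm (Fin (2 * n + 1)) //
        IsJacobi π ∧ Avoids231 π ∧ lastVal π = k} : ℚ)
      = ∑ m ∈ Finset.range n,
          (((n : ℚ) + (k : ℚ) - 3 * (m : ℚ) - 1) / ((n : ℚ) + (k : ℚ) - 1))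
            * (intChoose ((n : ℤ) - (m : ℤ)) ((k : ℤ) - 2 * (m : ℤ) - 1) : ℤ)
            * (intChoose ((n : ℤ) + (k : ℤ) - 1) (m : ℤ) : ℤ) := by
  exact ⟨(JacAux.card_eq _ _ (by omega) hk).trans (JacAux.W_even' n k hn hk),
    (JacAux.card_eq _ _ (by omega) hk).trans (JacAux.W_odd' n k hn hk)⟩
end

section
/- For all n ≥ 1, the number of Jacobi permutations of [n] avoiding the pattern 123 equals Σ_{k=0}^{⌊(n−1)/2⌋} (1/(2k+1))·C(n−k−1, k)·C(n, 2k). -/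
open PowerSeries in
noncomputable def ppG : PowerSeries ℚ := (1 - X ^ 2)⁻¹

open PowerSeries in
noncomputable def ppF : PowerSeries ℚ := 1 + X * ppG

open PowerSeries in
noncomputable def ppK : PowerSeries ℚ := ppF - X * derivative ℚ ppF

open PowerSeries in
noncomputable def ppM : PowerSeries ℚ := 1 - ppF⁻¹

open PowerSeries in
noncomputable def ppL (n : ℕ) (H : PowerSeries ℚ) : ℚ :=
  coeff n (H * ppF⁻¹ * ppF ^ n * ppK)

open PowerSeries in
lemma ppG_mul : (1 - X ^ 2) * ppG = 1 := by
  unfold ppG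
  apply PowerSeries.mul_inv_cancel
  simp

open PowerSeries in
lemma ppF_const : constantCoeff ppF = 1 := by
  simp [ppF]

open PowerSeries in
lemma ppF_mul : ppF * ppF⁻¹ = 1 := by
  apply PowerSeries.mul_inv_cancel
  simp [ppF_const]

open PowerSeries in
lemma ppL_shift (n : ℕ) (H : PowerSeries ℚ) : ppL (n + 1) (X * ppF⁻¹ * H) = ppL n H := by
  unfold ppL
  have : X * ppF⁻¹ * H * ppF⁻¹ * ppF ^ (n + 1) * ppK = X * (H * ppF⁻¹ * ppF ^ n * ppK) := by
    linear_combination (X * H * ppF⁻¹ * ppF ^ n * ppK) * ppF_mul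
  rw [this, coeff_succ_X_mul]

open PowerSeries in
lemma ppL_add (n : ℕ) (H J : PowerSeries ℚ) : ppL n (H + J) = ppL n H + ppL n J := by
  simp [ppL, add_mul]

open PowerSeries in
lemma ppL_sum (n : ℕ) (s : Finset ℕ) (f : ℕ → PowerSeries ℚ) :
    ppL n (∑ i ∈ s, f i) = ∑ i ∈ s, ppL n (f i) := by
  simp [ppL, Finset.sum_mul]

open PowerSeries in
lemma ppL_high (n m : ℕ) (h : n < m) (H : PowerSeries ℚ) : ppL n (X ^ m * H) = 0 := by
  unfold ppL
  rw [mul_assoc, mul_assoc, mul_assoc, coeff_X_pow_mul']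
  simp [h]

open PowerSeries in
lemma ppM_dvd : (X : PowerSeries ℚ) ∣ ppM := by
  rw [X_dvd_iff]
  simp [ppM, ppF_const]

open PowerSeries in
lemma ppL_M_high (n m : ℕ) (h : n < m) (H : PowerSeries ℚ) : ppL n (ppM ^ m * H) = 0 := by
  obtain ⟨c, hc⟩ := ppM_dvd
  rw [hc, mul_pow, mul_assoc]
  exact ppL_high n m h _

open PowerSeries in
lemma ppM_eq : ppM = X * ppF⁻¹ * (1 + X * (ppF * ppM)) := by
  have h1 : ppF * ppM = X * ppG := by
    have : ppF * ppM = ppF - 1 := by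
      unfold ppM
      linear_combination - ppF_mul
    rw [this, ppF]; ring
  have h2 : ppM = ppF⁻¹ * (ppF * ppM) := by
    linear_combination (- ppM) * ppF_mul
  rw [h1]
  rw [h1] at h2
  rw [h2]
  linear_combination (X * ppF⁻¹) * ppG_mul

open PowerSeries in
lemma ppM_geom (d N : ℕ) (h : d ≤ N) :
    ∑ i ∈ Finset.Ico d N, ppM ^ i = ppM ^ d * ppF - ppM ^ N * ppF := by
  induction N, h using Nat.le_induction with
  | base => simp
  | succ N hN ih =>
    rw [Finset.sum_Ico_succ_top hN, ih]
    have : ppF * (1 - ppM) = 1 := by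
      unfold ppM
      linear_combination ppF_mul
    linear_combination (-ppM ^ N) * this

open PowerSeries in
lemma ppL_geom (n d : ℕ) (H : PowerSeries ℚ) :
    ∑ i ∈ Finset.Ico d (n + 1), ppL n (ppM ^ i * H) = ppL n (ppM ^ d * (ppF * H)) := by
  rcases le_total d (n + 1) with h | h
  · rw [← ppL_sum, ← Finset.sum_mul, ppM_geom d _ h]
    have := ppL_M_high n (n + 1) (by omega) (ppF * H)
    have h2 := ppL_add n ((ppM ^ d * ppF - ppM ^ (n + 1) * ppF) * H) (ppM ^ (n + 1) * (ppF * H))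
    rw [this, add_zero] at h2
    rw [← h2]
    congr 1
    ring
  · rw [Finset.Ico_eq_empty (by omega), Finset.sum_empty, ppL_M_high n d (by omega)]

open PowerSeries in
lemma ppL_rec_even (n d : ℕ) : ppL (n + 1) (ppM ^ (d + 1)) =
    ppL n (ppM ^ d) + ∑ i ∈ Finset.Ico (d + 1) (n + 1), ppL n (ppM ^ i * X) := by
  rw [ppL_geom, ← ppL_add, ← ppL_shift n (_ + _)]
  congr 1
  rw [pow_succ]
  linear_combination (ppM ^ d) * ppM_eq

open PowerSeries in
lemma ppL_rec_odd (n d : ℕ) : ppL (n + 1) (ppM ^ (d + 1) * X) =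
    ∑ i ∈ Finset.Ico (d + 1) (n + 1), ppL n (ppM ^ i) := by
  have := ppL_geom n (d + 1) 1
  simp only [mul_one] at this
  rw [this, ← ppL_shift n (_ * _)]
  congr 1
  linear_combination (- (X : PowerSeries ℚ) * ppM ^ (d + 1)) * ppF_mul

open PowerSeries in
lemma coeff_pow_K (n : ℕ) : ((n : ℚ) + 1) * coeff (n + 1) (ppF ^ n * ppK) = 0 := by
  have h : ((n : PowerSeries ℚ) + 1) * (ppF ^ n * ppK) =
      ((n : PowerSeries ℚ) + 1) * ppF ^ (n + 1) - X * derivative ℚ (ppF ^ (n + 1)) := by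
    rw [Derivation.leibniz_pow]
    simp only [ppK, nsmul_eq_mul, smul_eq_mul, Nat.add_sub_cancel]
    push_cast
    ring
  have h2 := congrArg (coeff (n + 1)) h
  rw [map_sub, coeff_succ_X_mul] at h2
  have hc : ((n : PowerSeries ℚ) + 1) = C ((n : ℚ) + 1) := by simp
  rw [hc, coeff_C_mul, coeff_C_mul] at h2
  rw [h2, coeff_derivative]
  ring

open PowerSeries in
lemma ppL_one (n : ℕ) : ppL (n + 1) 1 = 0 := by
  have h := coeff_pow_K n
  have h3 : ((n : ℚ) + 1) ≠ 0 := by positivity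
  have h4 := (mul_eq_zero.mp h).resolve_left h3
  rw [ppL, ← h4]
  congr 1
  linear_combination (ppF ^ n * ppK) * ppF_mul

open PowerSeries in
lemma ppL_zero_one : ppL 0 1 = 1 := by
  simp [ppL, ppK, ppF_const]

open PowerSeries in
lemma ppL_F (n : ℕ) : ppL n ppF = 1 / ((n : ℚ) + 1) * coeff n (ppF ^ (n + 1)) := by
  have h : ((n : PowerSeries ℚ) + 1) * (ppF ^ n * ppK) =
      ((n : PowerSeries ℚ) + 1) * ppF ^ (n + 1) - X * derivative ℚ (ppF ^ (n + 1)) := by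
    rw [Derivation.leibniz_pow]
    simp only [ppK, nsmul_eq_mul, smul_eq_mul, Nat.add_sub_cancel]
    push_cast
    ring
  have h2 := congrArg (coeff n) h
  have hc : ((n : PowerSeries ℚ) + 1) = C ((n : ℚ) + 1) := by simp
  have hd : coeff n (X * derivative ℚ (ppF ^ (n + 1))) = n * coeff n (ppF ^ (n + 1)) := by
    cases n with
    | zero => simp
    | succ m =>
      rw [coeff_succ_X_mul, coeff_derivative]
      push_cast; ring
  rw [map_sub, hd, hc, coeff_C_mul, coeff_C_mul] at h2
  have h4 : ppL n ppF = coeff n (ppF ^ n * ppK) := by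
    rw [ppL, ppF_mul, one_mul]
  have h3 : ((n : ℚ) + 1) ≠ 0 := by positivity
  rw [h4]
  field_simp
  linarith

open PowerSeries in
lemma ppG_pow (r : ℕ) : ppG ^ r =
    mk (fun m => if m % 2 = 0 then (((r + m / 2 - 1).choose (m / 2) : ℕ) : ℚ) else 0) := by
  induction r with
  | zero =>
    ext m
    rw [pow_zero, coeff_mk, coeff_one]
    rcases Nat.eq_zero_or_pos m with rfl | hm
    · simp
    · rw [if_neg (by omega)]
      split_ifs with h
      · rw [Nat.choose_eq_zero_of_lt (by omega)]; simp
      · rfl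
  | succ r ih =>
    have key : ppG ^ r = (1 - X ^ 2) * mk (fun m => if m % 2 = 0 then
        (((r + 1 + m / 2 - 1).choose (m / 2) : ℕ) : ℚ) else 0) := by
      rw [ih]
      ext m
      rw [sub_mul, one_mul, map_sub, coeff_X_pow_mul', coeff_mk, coeff_mk]
      rcases m with _ | _ | m
      · simp
      · simp
      · rw [if_pos (show 2 ≤ m + 1 + 1 by omega), coeff_mk]
        simp only [show m + 1 + 1 - 2 = m by omega,
          show (m + 1 + 1) % 2 = m % 2 by omega, show (m + 1 + 1) / 2 = m / 2 + 1 by omega]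
        split_ifs with h
        · have e1 : r + (m / 2 + 1) - 1 = r + m / 2 := by omega
          have e2 : r + 1 + (m / 2 + 1) - 1 = r + m / 2 + 1 := by omega
          have e3 : r + 1 + m / 2 - 1 = r + m / 2 := by omega
          rw [e1, e2, e3, Nat.choose_succ_succ]
          push_cast; ring
        · simp
    rw [pow_succ, key]
    linear_combination (mk (fun m => if m % 2 = 0 then
        (((r + 1 + m / 2 - 1).choose (m / 2) : ℕ) : ℚ) else 0)) * ppG_mul

open PowerSeries in
lemma ppF_coeff (n : ℕ) (hn : 1 ≤ n) : 1 / ((n : ℚ) + 1) * coeff n (ppF ^ (n + 1)) =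
    ∑ k ∈ Finset.range ((n - 1) / 2 + 1),
      (1 / (2 * (k : ℚ) + 1)) * ((n - k - 1).choose k : ℕ) * (n.choose (2 * k) : ℕ) := by
  have h1 : ppF ^ (n + 1) = ∑ r ∈ Finset.range (n + 1 + 1),
      X ^ r * ppG ^ r * ((n + 1).choose r : PowerSeries ℚ) := by
    rw [ppF, add_comm, add_pow]
    simp [mul_pow]
  have h2 : coeff n (ppF ^ (n + 1)) = ∑ r ∈ Finset.range (n + 1),
      (if r % 2 = 0 then (((n - r / 2 - 1).choose (r / 2) : ℕ) : ℚ) else 0) *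
        ((n + 1).choose (r + 1) : ℕ) := by
    rw [h1, map_sum, Finset.sum_range_succ, ← Finset.sum_range_reflect]
    have hz : coeff n (X ^ (n + 1) * ppG ^ (n + 1) *
        ((n + 1).choose (n + 1) : PowerSeries ℚ)) = 0 := by
      rw [mul_assoc, coeff_X_pow_mul']; simp
    rw [hz, add_zero]
    apply Finset.sum_congr rfl
    intro r hr
    have hr' : r ≤ n := by simpa [Nat.lt_succ_iff] using hr
    have e : n + 1 - 1 - r = n - r := by omega
    rw [e, mul_assoc, coeff_X_pow_mul', if_pos (by omega),
      show n - (n - r) = r by omega, ← map_natCast (C : ℚ →+* PowerSeries ℚ), coeff_mul_C, ppG_pow, coeff_mk]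
    rw [show (n + 1).choose (n - r) = (n + 1).choose (r + 1) by
      apply Nat.choose_symm_of_eq_add; omega]
    congr 1
    split_ifs with h
    · rw [show n - r + r / 2 - 1 = n - r / 2 - 1 by omega]
    · rfl
  rw [h2, Finset.mul_sum]
  symm
  apply Finset.sum_of_injOn (fun k => 2 * k)
  · intro a _ b _ h
    simp only at h; omega
  · intro k hk
    simp only [Finset.coe_range, Set.mem_Iio] at hk ⊢
    omega
  · intro r hr hr2
    simp only [Finset.mem_range, Finset.coe_range, Set.mem_image, Set.mem_Iio, not_exists, not_and] at hr hr2
    split_ifs with h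
    · have := hr2 (r / 2)
      rw [Nat.choose_eq_zero_of_lt (by omega)]; simp
    · simp
  · intro k hk
    simp only [Nat.mul_mod_right, if_true, show 2 * k / 2 = k by omega]
    have := Nat.add_one_mul_choose_eq n (2 * k)
    have h3 : ((n : ℚ) + 1) * (n.choose (2 * k) : ℕ) = ((n + 1).choose (2 * k + 1) : ℕ) * (2 * k + 1) := by
      exact_mod_cast this
    have h4 : (n : ℚ) + 1 ≠ 0 := by positivity
    have h5 : 2 * (k : ℚ) + 1 ≠ 0 := by positivity
    field_simp
    linear_combination (((n - k - 1).choose k : ℕ) : ℚ) * h3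

/-- Append the value `v` at the end of `σ`. -/
def appP {n : ℕ} (v : Fin (n + 1)) (σ : Equiv.Perm (Fin n)) : Equiv.Perm (Fin (n + 1)) :=
  ((finSuccEquiv' (Fin.last n)).trans (Equiv.optionCongr σ)).trans (finSuccEquiv' v).symm

lemma appP_last {n : ℕ} (v : Fin (n + 1)) (σ : Equiv.Perm (Fin n)) :
    appP v σ (Fin.last n) = v := by
  simp [appP]

lemma appP_castSucc {n : ℕ} (v : Fin (n + 1)) (σ : Equiv.Perm (Fin n)) (i : Fin n) :
    appP v σ i.castSucc = v.succAbove (σ i) := by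
  have h : finSuccEquiv' (Fin.last n) i.castSucc = some i := by
    have := finSuccEquiv'_succAbove (Fin.last n) i
    rwa [Fin.succAbove_last_apply] at this
  simp [appP, h]

lemma appP_bij (n : ℕ) : Function.Bijective
    (fun p : Equiv.Perm (Fin n) × Fin (n + 1) => appP p.2 p.1) := by
  rw [Fintype.bijective_iff_injective_and_card]
  constructor
  · rintro ⟨σ, v⟩ ⟨τ, w⟩ h
    simp only at h
    have h1 : v = w := by rw [← appP_last v σ, h, appP_last]
    subst h1
    congr 1
    ext i
    have : v.succAbove (σ i) = v.succAbove (τ i) := by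
      rw [← appP_castSucc, h, appP_castSucc]
    rw [Fin.succAbove_right_injective this]
  · simp [Fintype.card_perm, Nat.factorial_succ, mul_comm]

/-- Smallest top of an ascent pair (or `n`). -/
noncomputable def dst {n : ℕ} (π : Equiv.Perm (Fin n)) : ℕ :=
  sInf ({n} ∪ {m | ∃ i j : Fin n, i < j ∧ π i < π j ∧ (π j : ℕ) = m})

lemma le_dst {n : ℕ} (π : Equiv.Perm (Fin n)) (x : ℕ) :
    x ≤ dst π ↔ x ≤ n ∧ ∀ i j : Fin n, i < j → π i < π j → x ≤ π j := by
  unfold dst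
  rw [le_csInf_iff (OrderBot.bddBelow _) ⟨n, by simp⟩]
  constructor
  · intro h
    exact ⟨h n (by simp), fun i j hij hp => h _ (Or.inr ⟨i, j, hij, hp, rfl⟩)⟩
  · rintro ⟨h1, h2⟩ b (hb | ⟨i, j, hij, hp, rfl⟩)
    · rw [Set.mem_singleton_iff] at hb; omega
    · exact h2 i j hij hp

lemma dst_le {n : ℕ} (π : Equiv.Perm (Fin n)) : dst π ≤ n := ((le_dst π _).1 le_rfl).1

lemma sa_lt {n : ℕ} (v : Fin (n + 1)) (a b : Fin n) : v.succAbove a < v.succAbove b ↔ a < b :=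
  Fin.succAbove_lt_succAbove_iff

lemma sa_lt_self {n : ℕ} (v : Fin (n + 1)) (a : Fin n) : v.succAbove a < v ↔ (a : ℕ) < v := by
  rw [Fin.succAbove_lt_iff_castSucc_lt]; rfl

lemma sa_val {n : ℕ} (v : Fin (n + 1)) (a : Fin n) :
    (v.succAbove a : ℕ) = if (a : ℕ) < v then (a : ℕ) else a + 1 := by
  unfold Fin.succAbove
  simp only [Fin.lt_def, Fin.val_castSucc]
  split_ifs <;> simp

lemma avoids_appP {n : ℕ} (v : Fin (n + 1)) (σ : Equiv.Perm (Fin n)) :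
    Avoids123 (appP v σ) ↔ Avoids123 σ ∧ (v : ℕ) ≤ dst σ := by
  rw [le_dst]
  constructor
  · intro h
    refine ⟨?_, by omega, ?_⟩
    · rintro ⟨i, j, k, hij, hjk, h1, h2⟩
      apply h
      refine ⟨i.castSucc, j.castSucc, k.castSucc, by simpa, by simpa, ?_, ?_⟩
      · simpa [appP_castSucc, sa_lt]
      · simpa [appP_castSucc, sa_lt]
    · intro i j hij hp
      by_contra hc
      apply h
      refine ⟨i.castSucc, j.castSucc, Fin.last n, by simpa, Fin.castSucc_lt_last j, ?_, ?_⟩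
      · simpa [appP_castSucc, sa_lt]
      · rw [appP_castSucc, appP_last, sa_lt_self]; omega
  · rintro ⟨h1, _, h2⟩ ⟨i, j, k, hij, hjk, hp, hq⟩
    induction j using Fin.lastCases with
    | last => exact absurd hjk (not_lt.2 (Fin.le_last k))
    | cast j =>
      induction i using Fin.lastCases with
      | last => exact absurd hij (not_lt.2 (Fin.le_last _))
      | cast i =>
        rw [appP_castSucc, appP_castSucc, sa_lt] at hp
        induction k using Fin.lastCases with
        | last =>
          rw [appP_castSucc, appP_last, sa_lt_self] at hq
          have := h2 i j (by simpa using hij) hp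
          omega
        | cast k =>
          rw [appP_castSucc, appP_castSucc, sa_lt] at hq
          exact h1 ⟨i, j, k, by simpa using hij, by simpa using hjk, hp, hq⟩

lemma le_dst_appP {n : ℕ} (v : Fin (n + 1)) (σ : Equiv.Perm (Fin n)) (x : ℕ) :
    x ≤ dst (appP v σ) ↔ x ≤ n + 1 ∧
      (∀ i j : Fin n, i < j → σ i < σ j → x ≤ (v.succAbove (σ j) : ℕ)) ∧
      (∀ i : Fin n, (σ i : ℕ) < v → x ≤ v) := by
  rw [le_dst]
  refine and_congr_right fun _ => ?_
  constructor
  · intro h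
    constructor
    · intro i j hij hp
      have := h i.castSucc j.castSucc (by simpa) (by simpa [appP_castSucc, sa_lt])
      rwa [appP_castSucc] at this
    · intro i hi
      have := h i.castSucc (Fin.last n) (Fin.castSucc_lt_last i)
        (by rw [appP_castSucc, appP_last, sa_lt_self]; exact hi)
      rwa [appP_last] at this
  · rintro ⟨h1, h2⟩ i j hij hp
    induction i using Fin.lastCases with
    | last => exact absurd hij (not_lt.2 (Fin.le_last _))
    | cast i =>
      induction j using Fin.lastCases with
      | last =>
        rw [appP_castSucc, appP_last, sa_lt_self] at hp
        rw [appP_last]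
        exact h2 i hp
      | cast j =>
        rw [appP_castSucc, appP_castSucc, sa_lt] at hp
        rw [appP_castSucc]
        exact h1 i j (by simpa using hij) hp

lemma dst_appP_zero {n : ℕ} (σ : Equiv.Perm (Fin n)) : dst (appP 0 σ) = dst σ + 1 := by
  apply eq_of_forall_le_iff
  intro x
  rw [le_dst_appP]
  cases x with
  | zero => simp
  | succ x =>
    rw [Nat.add_le_add_iff_right, Nat.add_le_add_iff_right, le_dst]
    simp

lemma dst_appP_pos {n : ℕ} (v : Fin (n + 1)) (σ : Equiv.Perm (Fin n)) (hv : 0 < (v : ℕ))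
    (hd : (v : ℕ) ≤ dst σ) : dst (appP v σ) = v := by
  apply eq_of_forall_le_iff
  intro x
  rw [le_dst_appP]
  rw [le_dst] at hd
  have hn : 0 < n := by omega
  constructor
  · rintro ⟨_, _, h⟩
    exact h (σ.symm ⟨0, hn⟩) (by simpa using hv)
  · intro h
    refine ⟨by omega, ?_, fun _ _ => h⟩
    intro i j hij hp
    have := hd.2 i j hij hp
    rw [sa_val]
    split_ifs <;> omega

lemma dst_pos {n : ℕ} (π : Equiv.Perm (Fin (n + 1))) : 0 < dst π := by
  rw [Nat.lt_iff_add_one_le, le_dst]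
  refine ⟨by omega, fun i j _ h => ?_⟩
  rw [Fin.lt_def] at h; omega

lemma rho_last {n : ℕ} (π : Equiv.Perm (Fin (n + 1))) : rhoLen π (Fin.last n) = 0 := by
  unfold rhoLen
  rw [Nat.card_eq_zero]
  left
  refine ⟨fun ⟨j, hj, _⟩ => absurd hj (not_lt.2 (Fin.le_last j))⟩

open Classical in
lemma rho_castSucc {n : ℕ} (v : Fin (n + 1)) (σ : Equiv.Perm (Fin n)) (k : Fin n) :
    rhoLen (appP v σ) k.castSucc = rhoLen σ k +
      if (∀ i : Fin n, k < i → σ k < σ i) ∧ (σ k : ℕ) < v then 1 else 0 := by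
  unfold rhoLen
  rw [Nat.card_eq_fintype_card, Nat.card_eq_fintype_card, Fintype.card_subtype,
    Fintype.card_subtype, Finset.card_filter, Finset.card_filter, Fin.sum_univ_castSucc]
  congr 1
  · apply Finset.sum_congr rfl
    intro j _
    congr 1
    rw [Fin.castSucc_lt_castSucc_iff, eq_iff_iff]
    refine and_congr_right fun _ => ?_
    constructor
    · intro h i h1 h2
      have := h i.castSucc (by simpa) (by simpa)
      rwa [appP_castSucc, appP_castSucc, sa_lt] at this
    · intro h i h1 h2
      induction i using Fin.lastCases with
      | last => exact absurd (Fin.castSucc_lt_last j) (not_lt.2 h2)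
      | cast i =>
        rw [appP_castSucc, appP_castSucc, sa_lt]
        exact h i (by simpa using h1) (by simpa using h2)
  · congr 1
    rw [eq_iff_iff]
    constructor
    · rintro ⟨_, h⟩
      constructor
      · intro i hi
        have := h i.castSucc (by simpa) (Fin.le_last _)
        rwa [appP_castSucc, appP_castSucc, sa_lt] at this
      · have := h (Fin.last n) (Fin.castSucc_lt_last k) le_rfl
        rwa [appP_castSucc, appP_last, sa_lt_self] at this
    · rintro ⟨h1, h2⟩
      refine ⟨Fin.castSucc_lt_last k, ?_⟩
      intro i hi _
      induction i using Fin.lastCases with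
      | last => rw [appP_castSucc, appP_last, sa_lt_self]; exact h2
      | cast i =>
        rw [appP_castSucc, appP_castSucc, sa_lt]
        exact h1 i (by simpa using hi)

/-- The parity state: exactly the smallest letter has a run of odd length. -/
def IsOddJ {n : ℕ} (π : Equiv.Perm (Fin n)) : Prop :=
  ∀ k : Fin n, Even (rhoLen π k) ↔ (π k : ℕ) ≠ 0

lemma rho_zero {n : ℕ} (σ : Equiv.Perm (Fin n)) (k : Fin n) :
    rhoLen (appP 0 σ) k.castSucc = rhoLen σ k := by
  rw [rho_castSucc]; simp

lemma rho_pos {n : ℕ} (v : Fin (n + 1)) (σ : Equiv.Perm (Fin n)) (k : Fin n)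
    (hv : 0 < (v : ℕ)) (hd : (v : ℕ) ≤ dst σ) :
    rhoLen (appP v σ) k.castSucc = rhoLen σ k + if (σ k : ℕ) = 0 then 1 else 0 := by
  classical
  rw [rho_castSucc]
  congr 1
  congr 1
  rw [eq_iff_iff]
  rw [le_dst] at hd
  have hn : 0 < n := by omega
  constructor
  · rintro ⟨h1, h2⟩
    by_contra hc
    have hz : (σ (σ.symm ⟨0, hn⟩) : ℕ) = 0 := by simp
    rcases lt_trichotomy k (σ.symm ⟨0, hn⟩) with h | h | h
    · have := h1 _ h
      rw [Fin.lt_def] at this; omega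
    · rw [h] at hc; exact hc hz
    · have := hd.2 _ _ h (by rw [Fin.lt_def]; omega)
      omega
  · intro h
    refine ⟨fun i hi => ?_, by omega⟩
    rw [Fin.lt_def]
    have : σ k ≠ σ i := fun he => (ne_of_lt hi) (σ.injective he)
    rw [Ne, Fin.ext_iff] at this
    omega

lemma jac_zero {n : ℕ} (σ : Equiv.Perm (Fin n)) : IsJacobi (appP 0 σ) ↔ IsJacobi σ := by
  unfold IsJacobi
  rw [Fin.forall_fin_succ']
  simp [rho_last, rho_zero]

lemma odd_zero {n : ℕ} (σ : Equiv.Perm (Fin n)) : ¬ IsOddJ (appP 0 σ) := by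
  intro h
  have := h (Fin.last n)
  simp [rho_last, appP_last] at this

lemma jac_pos {n : ℕ} (v : Fin (n + 1)) (σ : Equiv.Perm (Fin n))
    (hv : 0 < (v : ℕ)) (hd : (v : ℕ) ≤ dst σ) : IsJacobi (appP v σ) ↔ IsOddJ σ := by
  unfold IsJacobi IsOddJ
  rw [Fin.forall_fin_succ']
  simp only [rho_last, rho_pos v σ _ hv hd, Even.zero, and_true]
  refine forall_congr' fun k => ?_
  split_ifs with h
  · simp [h, Nat.even_add_one]
  · simp [h]

lemma odd_pos {n : ℕ} (v : Fin (n + 1)) (σ : Equiv.Perm (Fin n))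
    (hv : 0 < (v : ℕ)) (hd : (v : ℕ) ≤ dst σ) : IsOddJ (appP v σ) ↔ IsJacobi σ := by
  unfold IsJacobi IsOddJ
  rw [Fin.forall_fin_succ']
  simp only [rho_last, rho_pos v σ _ hv hd, Even.zero, appP_last, appP_castSucc, sa_val]
  rw [and_iff_left (by simp only [true_iff]; omega)]
  refine forall_congr' fun k => ?_
  split_ifs with h h2 h2
  · simp [h, Nat.even_add_one]
  · omega
  · simp [h]
  · simp

open Classical in
noncomputable def cE (n d : ℕ) : ℚ :=
  ∑ π : Equiv.Perm (Fin n), if Avoids123 π ∧ IsJacobi π ∧ dst π = d then 1 else 0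

open Classical in
noncomputable def cO (n d : ℕ) : ℚ :=
  ∑ π : Equiv.Perm (Fin n), if Avoids123 π ∧ IsOddJ π ∧ dst π = d then 1 else 0

lemma sum_perm_succ (n : ℕ) (f : Equiv.Perm (Fin (n + 1)) → ℚ) :
    ∑ π, f π = ∑ σ : Equiv.Perm (Fin n), (f (appP 0 σ) + ∑ v : Fin n, f (appP v.succ σ)) := by
  rw [← (appP_bij n).sum_comp, Fintype.sum_prod_type]
  simp only [Fin.sum_univ_succ]

open Classical in
lemma sum_ico {n : ℕ} (σ : Equiv.Perm (Fin n)) (P Q : Prop) (d : ℕ) :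
    (if P ∧ Q ∧ d ≤ dst σ then (1 : ℚ) else 0) =
      ∑ i ∈ Finset.Ico d (n + 1), if P ∧ Q ∧ dst σ = i then 1 else 0 := by
  have := dst_le σ
  by_cases hP : P <;> by_cases hQ : Q <;> simp [hP, hQ]
  congr 1
  rw [eq_iff_iff]
  omega

open Classical in
lemma sum_v {n : ℕ} (σ : Equiv.Perm (Fin n)) (P Q : Prop) (d : ℕ) :
    (∑ v : Fin n, if P ∧ Q ∧ (v : ℕ) + 1 ≤ dst σ ∧ (v : ℕ) = d then (1 : ℚ) else 0) =
      if P ∧ Q ∧ d + 1 ≤ dst σ then 1 else 0 := by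
  have hd := dst_le σ
  by_cases h : d < n
  · rw [Finset.sum_eq_single (⟨d, h⟩ : Fin n)]
    · simp
    · intro b _ hb
      rw [if_neg]
      rintro ⟨_, _, _, h3⟩
      exact hb (Fin.ext h3)
    · simp
  · rw [if_neg (by omega)]
    apply Finset.sum_eq_zero
    intro v _
    rw [if_neg]
    rintro ⟨_, _, _, h3⟩
    omega

lemma cE_rec (n d : ℕ) : cE (n + 1) (d + 1) =
    cE n d + ∑ i ∈ Finset.Ico (d + 1) (n + 1), cO n i := by
  classical
  unfold cE cO
  rw [sum_perm_succ, Finset.sum_comm, ← Finset.sum_add_distrib]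
  apply Finset.sum_congr rfl
  intro σ _
  congr 1
  · simp [avoids_appP, jac_zero, dst_appP_zero]
  · rw [← sum_ico, ← sum_v]
    apply Finset.sum_congr rfl
    intro v _
    congr 1
    rw [eq_iff_iff, avoids_appP]
    have hv : 0 < (v.succ : ℕ) := by simp
    constructor
    · rintro ⟨⟨h1, h2⟩, h3, h4⟩
      rw [jac_pos _ _ hv h2] at h3
      rw [dst_appP_pos _ _ hv h2] at h4
      simp at h2 h4
      exact ⟨h1, h3, h2, h4⟩
    · rintro ⟨h1, h3, h2, h4⟩
      have h2' : (v.succ : ℕ) ≤ dst σ := by simpa using h2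
      refine ⟨⟨h1, h2'⟩, (jac_pos _ _ hv h2').2 h3, ?_⟩
      rw [dst_appP_pos _ _ hv h2']
      simpa

lemma cO_rec (n d : ℕ) : cO (n + 1) (d + 1) =
    ∑ i ∈ Finset.Ico (d + 1) (n + 1), cE n i := by
  classical
  unfold cE cO
  rw [sum_perm_succ, Finset.sum_comm]
  apply Finset.sum_congr rfl
  intro σ _
  rw [if_neg (fun h => odd_zero σ h.2.1), zero_add]
  rw [← sum_ico, ← sum_v]
  apply Finset.sum_congr rfl
  intro v _
  congr 1
  rw [eq_iff_iff, avoids_appP]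
  have hv : 0 < (v.succ : ℕ) := by simp
  constructor
  · rintro ⟨⟨h1, h2⟩, h3, h4⟩
    rw [odd_pos _ _ hv h2] at h3
    rw [dst_appP_pos _ _ hv h2] at h4
    simp at h2 h4
    exact ⟨h1, h3, h2, h4⟩
  · rintro ⟨h1, h3, h2, h4⟩
    have h2' : (v.succ : ℕ) ≤ dst σ := by simpa using h2
    refine ⟨⟨h1, h2'⟩, (odd_pos _ _ hv h2').2 h3, ?_⟩
    rw [dst_appP_pos _ _ hv h2']
    simpa

lemma cE_succ_zero (n : ℕ) : cE (n + 1) 0 = 0 := by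
  classical
  apply Finset.sum_eq_zero
  intro π _
  rw [if_neg]
  rintro ⟨_, _, h⟩
  have := dst_pos π
  omega

lemma cE_zero (d : ℕ) : cE 0 d = if d = 0 then 1 else 0 := by
  classical
  unfold cE
  rw [Fintype.sum_unique]
  congr 1
  have h := dst_le (default : Equiv.Perm (Fin 0))
  rw [eq_iff_iff]
  constructor
  · rintro ⟨_, _, h2⟩; omega
  · intro h2
    exact ⟨fun ⟨i, _⟩ => i.elim0, fun i => i.elim0, by omega⟩

lemma cO_zero (d : ℕ) : cO 0 (d + 1) = 0 := by
  classical
  apply Finset.sum_eq_zero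
  intro π _
  rw [if_neg]
  rintro ⟨_, _, h⟩
  have := dst_le π
  omega

lemma c_eq (n : ℕ) : (∀ d, cE n d = ppL n (ppM ^ d)) ∧
    (∀ d, cO n (d + 1) = ppL n (ppM ^ (d + 1) * PowerSeries.X)) := by
  induction n with
  | zero =>
    constructor
    · intro d
      rw [cE_zero]
      cases d with
      | zero => simp [ppL_zero_one]
      | succ d =>
        have := ppL_M_high 0 (d + 1) (by omega) 1
        rw [mul_one] at this
        simp [this]
    · intro d
      rw [cO_zero, ppL_M_high 0 (d + 1) (by omega)]
  | succ n ih =>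
    obtain ⟨h1, h2⟩ := ih
    constructor
    · intro d
      cases d with
      | zero => rw [cE_succ_zero, pow_zero, ppL_one]
      | succ d =>
        rw [cE_rec, ppL_rec_even, h1]
        congr 1
        apply Finset.sum_congr rfl
        intro i hi
        rw [Finset.mem_Ico] at hi
        obtain ⟨j, rfl⟩ : ∃ j, i = j + 1 := ⟨i - 1, by omega⟩
        exact h2 j
    · intro d
      rw [cO_rec, ppL_rec_odd]
      exact Finset.sum_congr rfl fun i _ => h1 i

/-- Enumeration of 123-avoiding Jacobi permutations of `[n]`. -/
theorem jacobi_avoid_123_count (n : ℕ) (hn : 1 ≤ n) :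
    (Nat.card {π : Equiv.Perm (Fin n) // IsJacobi π ∧ Avoids123 π} : ℚ)
      = ∑ k ∈ Finset.range ((n - 1) / 2 + 1),
          (1 / (2 * (k : ℚ) + 1)) * ((n - k - 1).choose k : ℕ) * (n.choose (2 * k) : ℕ) := by
  classical
  rw [← ppF_coeff n hn, ← ppL_F]
  have h := ppL_geom n 0 1
  simp only [mul_one, pow_zero, one_mul] at h
  rw [← h, Finset.sum_congr rfl fun i _ => ((c_eq n).1 i).symm]
  unfold cE
  rw [Finset.sum_comm, Nat.card_eq_fintype_card, Fintype.card_subtype, Finset.card_filter]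
  push_cast
  apply Finset.sum_congr rfl
  intro σ _
  rw [← sum_ico]
  congr 1
  rw [eq_iff_iff]
  constructor
  · rintro ⟨h1, h2⟩; exact ⟨h2, h1, Nat.zero_le _⟩
  · rintro ⟨h1, h2, _⟩; exact ⟨h2, h1⟩
end

section
/- For all n ≥ k ≥ 0 with n and k of the same parity, the number of Jacobi permutations of [n] avoiding 123 with exactly k left-to-right minima equals (1/(n+1))·C(n+1, k)·C((n+k)/2 − 1, k−1); if n and k have opposite parity this count is 0. -/
/-- The number of left-to-right minima of `π`. -/
noncomputable def lrminCount {n : ℕ} (π : Equiv.Perm (Fin n)) : ℕ :=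
  Nat.card {k : Fin n // ∀ i : Fin n, i < k → π k < π i}

/-- The binomial coefficient `C(a,b)` for integers, with `C(a,b) = 0` whenever `b < 0` or
`b > a`, except for the convention `C(-1,-1) = 1`. -/
def chooseConv (a b : ℤ) : ℤ :=
  if a = -1 ∧ b = -1 then 1
  else if 0 ≤ b ∧ b ≤ a then (a.toNat.choose b.toNat : ℤ) else 0

/-- State predicate on (value functions of) inverse permutations: avoids 123, the values `≥ a`
are decreasing, the left-to-right minima below `a` have odd gaps, and there are `k` of them. -/
def RR {n : ℕ} (a k : ℕ) (f : Fin n → ℕ) : Prop :=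
  (∀ i j l : Fin n, i < j → j < l → f i < f j → ¬ f j < f l) ∧
  (∀ i j : Fin n, i < j → a ≤ f i → f j < f i) ∧
  (∀ v : Fin n, f v < a → (∀ w, w < v → f v < f w) →
    Even ((Finset.range a).filter (fun j => f v < j ∧ ∀ w, w < v → j < f w)).card) ∧
  (Finset.univ.filter (fun v : Fin n => f v < a ∧ ∀ w, w < v → f v < f w)).card = k

def shiftF {n : ℕ} (b : ℕ) (f : Fin n → ℕ) : Fin (n + 1) → ℕ :=
  Fin.cons b (fun i => if f i < b then f i else f i + 1)

theorem RR_lt {n : ℕ} (a b k : ℕ) (f : Fin n → ℕ) (hf : Function.Injective f) (hb : b < a) :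
    RR a k (shiftF b f) ↔ Odd (a - b) ∧ ∃ k', k = k' + 1 ∧ RR b k' f := by
  unfold RR
  have e1 : (∀ i j l : Fin (n+1), i < j → j < l → shiftF b f i < shiftF b f j →
      ¬ shiftF b f j < shiftF b f l) ∧
      (∀ i j : Fin (n+1), i < j → a ≤ shiftF b f i → shiftF b f j < shiftF b f i) ↔
      (∀ i j l : Fin n, i < j → j < l → f i < f j → ¬ f j < f l) ∧
      (∀ i j : Fin n, i < j → b ≤ f i → f j < f i) := by
    constructor
    · rintro ⟨h1, h2⟩
      constructor
      · intro i j l hij hjl h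
        have := h1 i.succ j.succ l.succ (by simpa) (by simpa)
        simp only [shiftF, Fin.cons_succ] at this
        split_ifs at this <;> omega
      · intro i j hij h
        have := h1 0 i.succ j.succ (by simp) (by simpa)
        simp only [shiftF, Fin.cons_succ, Fin.cons_zero] at this
        have hne : f i ≠ f j := fun h => hij.ne (hf h)
        split_ifs at this <;> omega
    · rintro ⟨h1, h2⟩
      constructor
      · intro i j l hij hjl
        cases l using Fin.cases with
        | zero => simp at hjl
        | succ l =>
        cases j using Fin.cases with
        | zero => simp at hij
        | succ j =>
        have hjl' : j < l := by simpa using hjl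
        cases i using Fin.cases with
        | zero =>
          have := h2 j l hjl'
          simp only [shiftF, Fin.cons_succ, Fin.cons_zero]
          split_ifs <;> omega
        | succ i =>
          have := h1 i j l (by simpa using hij) hjl'
          simp only [shiftF, Fin.cons_succ]
          split_ifs <;> omega
      · intro i j hij
        cases j using Fin.cases with
        | zero => simp at hij
        | succ j =>
        cases i using Fin.cases with
        | zero =>
          simp only [shiftF, Fin.cons_succ, Fin.cons_zero]
          omega
        | succ i =>
          have := h2 i j (by simpa using hij)
          simp only [shiftF, Fin.cons_succ]
          split_ifs <;> omega
  have key : ∀ v : Fin n, (shiftF b f v.succ < a ∧ ∀ w, w < v.succ → shiftF b f v.succ < shiftF b f w) ↔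
      (f v < b ∧ ∀ w, w < v → f v < f w) := by
    intro v
    simp only [Fin.forall_fin_succ, shiftF, Fin.cons_succ, Fin.cons_zero, Fin.succ_lt_succ_iff,
      Fin.succ_pos, forall_true_left]
    constructor
    · rintro ⟨h1, h2, h3⟩
      have hv : f v < b := by split_ifs at h2 <;> omega
      refine ⟨hv, fun w hw => ?_⟩
      have := h3 w hw
      split_ifs at this <;> omega
    · rintro ⟨h1, h2⟩
      refine ⟨?_, ?_, fun w hw => ?_⟩
      · split_ifs; omega
      · split_ifs; omega
      · have := h2 w hw
        split_ifs <;> omega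
  have e2 : (∀ v : Fin (n+1), shiftF b f v < a → (∀ w, w < v → shiftF b f v < shiftF b f w) →
    Even ((Finset.range a).filter (fun j => shiftF b f v < j ∧ ∀ w, w < v → j < shiftF b f w)).card) ↔
      Odd (a - b) ∧ (∀ v : Fin n, f v < b → (∀ w, w < v → f v < f w) →
    Even ((Finset.range b).filter (fun j => f v < j ∧ ∀ w, w < v → j < f w)).card) := by
    rw [Fin.forall_fin_succ]
    refine and_congr ?_ (forall_congr' fun v => ?_)
    · have : (Finset.range a).filter (fun j => shiftF b f 0 < j ∧ ∀ w, w < 0 → j < shiftF b f w)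
          = Finset.Ioo b a := by
        ext j
        simp [shiftF]
        omega
      rw [this]
      simp [shiftF, hb]
      rw [Nat.odd_iff, Nat.even_iff]
      omega
    · rw [← and_imp, ← and_imp, key]
      refine forall_congr' fun hv => ?_
      have : (Finset.range a).filter (fun j => shiftF b f v.succ < j ∧ ∀ w, w < v.succ → j < shiftF b f w)
          = (Finset.range b).filter (fun j => f v < j ∧ ∀ w, w < v → j < f w) := by
        ext j
        simp only [Finset.mem_filter, Finset.mem_range, Fin.forall_fin_succ, shiftF, Fin.cons_succ,
          Fin.cons_zero, Fin.succ_lt_succ_iff, Fin.succ_pos, forall_true_left, if_pos hv.1]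
        constructor
        · rintro ⟨h1, h2, h3, h4⟩
          refine ⟨h3, h2, fun w hw => ?_⟩
          have := h4 w hw
          split_ifs at this <;> omega
        · rintro ⟨h1, h2, h3⟩
          refine ⟨by omega, h2, h1, fun w hw => ?_⟩
          have := h3 w hw
          split_ifs <;> omega
      rw [this]
  have e3 : (Finset.univ.filter (fun v : Fin (n+1) => shiftF b f v < a ∧ ∀ w, w < v → shiftF b f v < shiftF b f w)).card
     = (Finset.univ.filter (fun v : Fin n => f v < b ∧ ∀ w, w < v → f v < f w)).card + 1 := by
    rw [Fin.card_filter_univ_succ]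
    rw [if_pos (by simp [shiftF, hb])]
    congr 2
    ext v
    simp only [Finset.mem_filter, Finset.mem_univ, true_and, Function.comp]
    exact key v
  rw [← and_assoc, e1, e2, e3]
  constructor
  · rintro ⟨⟨h1, h2⟩, ⟨h3, h4⟩, h5⟩
    exact ⟨h3, _, h5.symm, h1, h2, h4, rfl⟩
  · rintro ⟨h3, k', h5, h1, h2, h4, h6⟩
    exact ⟨⟨h1, h2⟩, ⟨h3, h4⟩, by omega⟩

theorem RR_ge {n : ℕ} (a k : ℕ) (f : Fin n → ℕ) (hf : ∀ i, f i < n) (hb : a ≤ n) :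
    RR a k (shiftF n f) ↔ RR a k f := by
  unfold RR
  have s0 : shiftF n f 0 = n := rfl
  have ss : ∀ i : Fin n, shiftF n f i.succ = f i := by intro i; simp [shiftF, hf]
  have key : ∀ v : Fin n, (shiftF n f v.succ < a ∧ ∀ w, w < v.succ → shiftF n f v.succ < shiftF n f w) ↔
      (f v < a ∧ ∀ w, w < v → f v < f w) := by
    intro v
    simp only [Fin.forall_fin_succ, s0, ss, Fin.succ_lt_succ_iff,
      Fin.succ_pos, forall_true_left, hf, true_and]
  refine and_congr ?_ (and_congr ?_ (and_congr ?_ ?_))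
  · simp only [Fin.forall_fin_succ, s0, ss, Fin.succ_lt_succ_iff,
      Fin.succ_pos, forall_true_left]
    constructor
    · rintro ⟨_, h⟩ i j l
      have := (h i).2 j
      exact this.2 l
    · intro h
      refine ⟨⟨by simp, fun i => ⟨by simp, fun j _ h => ?_⟩⟩, fun i => ⟨by simp, fun j => ⟨by simp, h i j⟩⟩⟩
      have := hf i
      omega
  · simp only [Fin.forall_fin_succ, s0, ss, Fin.succ_lt_succ_iff,
      Fin.succ_pos, forall_true_left, hf]
    simp
  · rw [Fin.forall_fin_succ]
    rw [and_iff_right (by intro h; rw [s0] at h; omega)]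
    refine forall_congr' fun v => ?_
    rw [← and_imp, ← and_imp, key]
    refine forall_congr' fun hv => ?_
    have : (Finset.range a).filter (fun j => shiftF n f v.succ < j ∧ ∀ w, w < v.succ → j < shiftF n f w)
          = (Finset.range a).filter (fun j => f v < j ∧ ∀ w, w < v → j < f w) := by
      ext j
      simp only [Finset.mem_filter, Finset.mem_range, Fin.forall_fin_succ, s0, ss,
        Fin.succ_lt_succ_iff, Fin.succ_pos, forall_true_left]
      refine and_congr_right fun h => and_congr_right fun _ => and_iff_right (by omega)
    rw [this]
  · rw [Fin.card_filter_univ_succ]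
    rw [if_neg (by simp [s0]; omega)]
    have : (Finset.univ.filter (fun v : Fin n => shiftF n f v.succ < a ∧ ∀ w, w < v.succ → shiftF n f v.succ < shiftF n f w)) = Finset.univ.filter (fun v : Fin n => f v < a ∧ ∀ w, w < v → f v < f w) := by
      ext v
      simp only [Finset.mem_filter, Finset.mem_univ, true_and]
      exact key v
    rw [this]

def pcons {n : ℕ} (b : Fin (n + 1)) (τ : Equiv.Perm (Fin n)) : Fin (n + 1) → Fin (n + 1) :=
  Fin.cons b (fun i => b.succAbove (τ i))

theorem pcons_inj {n : ℕ} (b : Fin (n + 1)) (τ : Equiv.Perm (Fin n)) :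
    Function.Injective (pcons b τ) := by
  unfold pcons
  rw [Fin.cons_injective_iff]
  constructor
  · rintro ⟨i, hi⟩
    exact Fin.succAbove_ne _ _ hi
  · intro i j h
    exact τ.injective (Fin.succAbove_right_injective h)

noncomputable def pconsE {n : ℕ} (x : Fin (n + 1) × Equiv.Perm (Fin n)) : Equiv.Perm (Fin (n + 1)) :=
  Equiv.ofBijective _ (Finite.injective_iff_bijective.mp (pcons_inj x.1 x.2))

theorem pconsE_bij {n : ℕ} : Function.Bijective (@pconsE n) := by
  rw [Fintype.bijective_iff_injective_and_card]
  constructor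
  · rintro ⟨b, τ⟩ ⟨c, σ⟩ h
    have h' : pcons b τ = pcons c σ := by
      have := congrArg (fun e : Equiv.Perm (Fin (n+1)) => (e : Fin (n+1) → Fin (n+1))) h
      simpa [pconsE] using this
    unfold pcons at h'
    rw [Fin.cons_inj] at h'
    obtain ⟨rfl, h2⟩ := h'
    congr 1
    ext i
    have := Fin.succAbove_right_injective (congrFun h2 i)
    rw [this]
  · simp [Fintype.card_perm, Nat.factorial_succ]

theorem pconsE_val {n : ℕ} (b : Fin (n + 1)) (τ : Equiv.Perm (Fin n)) :
    (fun i => ((pconsE (b, τ) i : Fin (n+1)) : ℕ)) = shiftF b (fun i => (τ i : ℕ)) := by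
  funext i
  cases i using Fin.cases with
  | zero => simp [pconsE, pcons, shiftF]
  | succ i =>
    simp only [pconsE, pcons, shiftF, Equiv.ofBijective_apply, Fin.cons_succ, Fin.succAbove,
      Fin.lt_def, Fin.val_castSucc]
    split_ifs <;> simp

noncomputable def QQ (n a k : ℕ) : ℕ :=
  Nat.card {σ : Equiv.Perm (Fin n) // RR a k (fun i => (σ i : ℕ))}

theorem RR_ge' {n : ℕ} (a k : ℕ) (b : Fin (n+1)) (τ : Equiv.Perm (Fin n)) (hb : a ≤ b) :
    RR a k (shiftF b (fun i => (τ i : ℕ))) ↔ (b : ℕ) = n ∧ RR a k (fun i => (τ i : ℕ)) := by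
  by_cases h : (b : ℕ) = n
  · rw [h] at hb ⊢
    rw [RR_ge _ _ _ (fun i => (τ i).2) hb]
    simp
  · simp only [h, false_and, iff_false]
    rintro ⟨-, h2, -⟩
    have hbn : (b : ℕ) < n := by omega
    have := h2 0 (τ.symm ⟨b, hbn⟩).succ (by simp) (by simpa [shiftF] using hb)
    simp [shiftF] at this

theorem QQ_succ (n a k : ℕ) (ha : a ≤ n + 1) :
    QQ (n + 1) a k = (if a ≤ n then QQ n a k else 0) +
      ∑ b ∈ Finset.range a, if Odd (a - b) ∧ 1 ≤ k then QQ n b (k - 1) else 0 := by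
  classical
  have h1 : QQ (n + 1) a k = ∑ b : Fin (n + 1),
      Nat.card {τ : Equiv.Perm (Fin n) // RR a k (shiftF b (fun i => (τ i : ℕ)))} := by
    unfold QQ
    rw [← Nat.card_sigma]
    symm
    refine Nat.card_congr ?_
    refine Equiv.trans ?_ ((Equiv.ofBijective _ (@pconsE_bij n)).subtypeEquiv
      (p := fun x => RR a k (shiftF x.1 (fun i => (x.2 i : ℕ)))) ?_)
    · exact (Equiv.subtypeProdEquivSigmaSubtype (fun (b : Fin (n+1)) (τ : Equiv.Perm (Fin n)) => RR a k (shiftF b (fun i => (τ i : ℕ))))).symm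
    · rintro ⟨b, τ⟩
      rw [← pconsE_val]
      rfl
  have h2 : ∀ b : Fin (n+1), Nat.card {τ : Equiv.Perm (Fin n) // RR a k (shiftF b (fun i => (τ i : ℕ)))}
     = (fun b : ℕ => if b < a then (if Odd (a - b) ∧ 1 ≤ k then QQ n b (k - 1) else 0)
        else if b = n then QQ n a k else 0) b := by
    intro b
    dsimp only
    split_ifs with c1 c2 c3
    · unfold QQ
      refine Nat.card_congr (Equiv.subtypeEquivRight fun τ => ?_)
      rw [RR_lt _ _ _ _ (fun i j h => τ.injective (Fin.ext h)) c1]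
      constructor
      · rintro ⟨_, k', h, h'⟩
        rw [h]; exact h'
      · intro h
        exact ⟨c2.1, k - 1, by omega, h⟩
    · rw [Nat.card_eq_zero]
      left
      constructor
      rintro ⟨τ, h⟩
      rw [RR_lt _ _ _ _ (fun i j h => τ.injective (Fin.ext h)) c1] at h
      obtain ⟨h1, k', h2, -⟩ := h
      exact c2 ⟨h1, by omega⟩
    · unfold QQ
      refine Nat.card_congr (Equiv.subtypeEquivRight fun τ => ?_)
      rw [RR_ge' _ _ _ _ (by omega), and_iff_right c3]
    · rw [Nat.card_eq_zero]
      left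
      constructor
      rintro ⟨τ, h⟩
      rw [RR_ge' _ _ _ _ (by omega)] at h
      exact c3 h.1
  rw [h1, Finset.sum_congr rfl (fun b _ => h2 b)]
  rw [Fin.sum_univ_eq_sum_range (fun b : ℕ => if b < a then (if Odd (a - b) ∧ 1 ≤ k then QQ n b (k - 1) else 0)
        else if b = n then QQ n a k else 0)]
  rw [Finset.sum_ite, add_comm]
  congr 1
  · split_ifs with h
    · rw [Finset.sum_ite_eq_of_mem']
      simp [h]
    · apply Finset.sum_eq_zero
      intro x hx
      simp at hx
      omega
  · apply Finset.sum_congr _ (fun _ _ => rfl)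
    ext x
    simp
    omega

def NN (a : ℕ) : ℕ → ℕ
  | 0 => if a = 0 then 1 else 0
  | k + 1 => if (a + k + 1) % 2 = 0 then ((a + k + 1) / 2 - 1).choose k else 0

theorem NN_rec (a k : ℕ) : NN (a + 2) (k + 1) = NN a (k + 1) + NN (a + 1) k := by
  cases k with
  | zero =>
    simp only [NN]
    simp
    split_ifs <;> omega
  | succ k =>
    simp only [NN]
    by_cases h : (a + k) % 2 = 0
    · rw [if_pos (by omega), if_pos (by omega), if_pos (by omega)]
      obtain ⟨m, hm⟩ : ∃ m, a + k = 2 * m := ⟨(a + k) / 2, by omega⟩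
      rw [show (a + 2 + (k + 1) + 1) / 2 - 1 = m + 1 by omega,
        show (a + (k + 1) + 1) / 2 - 1 = m by omega,
        show (a + 1 + k + 1) / 2 - 1 = m by omega, Nat.choose_succ_succ, Nat.succ_eq_add_one]
      omega
    · rw [if_neg (by omega), if_neg (by omega), if_neg (by omega)]

theorem NN_zero (k : ℕ) : NN 0 (k + 1) = 0 := by
  simp only [NN]
  split_ifs with h
  · apply Nat.choose_eq_zero_of_lt
    omega
  · rfl

theorem NN_one (k : ℕ) : NN 1 (k + 1) = NN 0 k := by
  cases k with
  | zero => simp [NN]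
  | succ k =>
    rw [NN_zero]
    simp only [NN]
    split_ifs with h
    · apply Nat.choose_eq_zero_of_lt
      omega
    · rfl

theorem NN_mul (a k : ℕ) : ((a : ℚ) + 1 - k) * NN (a + 1) k = 2 * k * NN a (k + 1) := by
  cases k with
  | zero => simp [NN]
  | succ k =>
    simp only [NN]
    by_cases h : (a + k) % 2 = 0
    · rw [if_pos (by omega), if_pos (by omega)]
      obtain ⟨m, hm⟩ : ∃ m, a + k = 2 * m := ⟨(a + k) / 2, by omega⟩
      rw [show (a + (k + 1) + 1) / 2 - 1 = m by omega,
        show (a + 1 + k + 1) / 2 - 1 = m by omega]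
      have hm' : (a : ℚ) = 2 * m - k := by
        have : (a : ℚ) + k = 2 * m := by exact_mod_cast hm
        linarith
      rw [hm']
      by_cases hk : k ≤ m
      · have := Nat.choose_succ_right_eq m k
        have h2 : (m.choose (k + 1) : ℚ) * (k + 1) = m.choose k * (m - k) := by
          rw [← Nat.cast_sub hk]
          exact_mod_cast this
        push_cast
        linear_combination -2 * h2
      · rw [Nat.choose_eq_zero_of_lt (by omega), Nat.choose_eq_zero_of_lt (by omega)]
        simp
    · rw [if_neg (by omega), if_neg (by omega)]
      simp

theorem sum_odd_step (g : ℕ → ℚ) (a : ℕ) :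
    (∑ b ∈ Finset.range (a + 2), if Odd (a + 2 - b) then g b else 0)
    = (∑ b ∈ Finset.range a, if Odd (a - b) then g b else 0) + g (a + 1) := by
  rw [Finset.sum_range_succ, Finset.sum_range_succ]
  rw [if_neg (by rw [Nat.odd_iff]; omega), if_pos (by rw [Nat.odd_iff]; omega), add_zero]
  congr 1
  apply Finset.sum_congr rfl
  intro b hb
  simp at hb
  have : Odd (a + 2 - b) ↔ Odd (a - b) := by rw [Nat.odd_iff, Nat.odd_iff]; omega
  simp only [this]

theorem sum_NN (k : ℕ) (a : ℕ) :
    (∑ b ∈ Finset.range a, if Odd (a - b) then (NN b k : ℚ) else 0) = NN a (k + 1) := by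
  induction a using Nat.twoStepInduction with
  | zero => simp [NN_zero]
  | one => simp [NN_one]
  | more a ih _ =>
    rw [sum_odd_step (fun b => (NN b k : ℚ)), ih, NN_rec]
    push_cast; ring

theorem sum_mul_NN (k : ℕ) (a : ℕ) :
    ((k : ℚ) + 1) * (∑ b ∈ Finset.range a, if Odd (a - b) then ((b : ℚ) * NN b k) else 0)
      = a * k * NN a (k + 1) := by
  induction a using Nat.twoStepInduction with
  | zero => simp
  | one =>
    cases k with
    | zero => simp
    | succ k => simp [NN_one, NN_zero]
  | more a ih _ =>
    rw [sum_odd_step (fun b => ((b : ℚ) * NN b k)), mul_add, ih, NN_rec]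
    have := NN_mul a k
    push_cast
    linear_combination this

theorem QQ_zero (k : ℕ) : QQ 0 0 k = if k = 0 then 1 else 0 := by
  unfold QQ RR
  split_ifs with h
  · subst h
    simp
  · rw [Nat.card_eq_zero]
    left
    constructor
    rintro ⟨σ, h1, h2, h3, h4⟩
    simp at h4
    omega

theorem QQ_formula (n : ℕ) : ∀ a k : ℕ, a ≤ n →
    ((n : ℚ) + 1) * QQ n a k = (n + 1 - a) * (n + 1).choose k * NN a k := by
  induction n with
  | zero =>
    intro a k ha
    obtain rfl : a = 0 := by omega
    rw [QQ_zero]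
    cases k with
    | zero => simp [NN]
    | succ k => simp [NN_zero]
  | succ n ih =>
    intro a k ha
    rw [QQ_succ n a k ha]
    have hn : ((n : ℚ) + 1) ≠ 0 := by positivity
    have hA : ((n : ℚ) + 1) * (if a ≤ n then QQ n a k else 0 : ℕ) =
        (n + 1 - a) * (n + 1).choose k * NN a k := by
      split_ifs with h
      · exact ih a k h
      · have : a = n + 1 := by omega
        subst this
        simp
    cases k with
    | zero =>
      simp only [Nat.choose_zero_right, NN] at hA ⊢
      have : ∀ b, ¬ (Odd (a - b) ∧ 1 ≤ 0) := by simp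
      simp only [this, if_false, Finset.sum_const_zero, add_zero]
      by_cases h : a = 0
      · subst h
        simp at hA ⊢
        have : (QQ n 0 0 : ℚ) = 1 := mul_left_cancel₀ hn (by linarith)
        rw [this]; ring
      · simp only [h, if_false, Nat.cast_zero, mul_zero] at hA ⊢
        rw [(mul_eq_zero.mp hA).resolve_left hn, mul_zero]
    | succ k =>
      have hB : ((n : ℚ) + 1) * (∑ b ∈ Finset.range a,
          if Odd (a - b) ∧ 1 ≤ k + 1 then QQ n b (k + 1 - 1) else 0 : ℕ) =
          (n + 1).choose k * ((n + 1) * NN a (k + 1)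
            - ∑ b ∈ Finset.range a, if Odd (a - b) then ((b : ℚ) * NN b k) else 0) := by
        rw [← sum_NN, Finset.mul_sum, ← Finset.sum_sub_distrib, Finset.mul_sum]
        push_cast
        rw [Finset.mul_sum]
        apply Finset.sum_congr rfl
        intro b hb
        simp at hb
        by_cases ho : Odd (a - b)
        · simp only [ho, true_and, le_add_iff_nonneg_left, zero_le, if_true, Nat.add_sub_cancel]
          rw [ih b k (by omega)]
          ring
        · simp [ho]
      have hC := sum_mul_NN k a
      set S := ∑ b ∈ Finset.range a, if Odd (a - b) then ((b : ℚ) * NN b k) else 0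
      have hk : ((k : ℚ) + 1) ≠ 0 := by positivity
      have c1 : ((n + 1 + 1).choose (k + 1) : ℚ) * (k + 1) = (n + 2) * (n + 1).choose k := by
        have := Nat.add_one_mul_choose_eq (n + 1) k
        have h : (((n + 1 + 1) * (n + 1).choose k : ℕ) : ℚ) = ((n + 1 + 1).choose (k + 1) * (k + 1) : ℕ) := by
          exact_mod_cast this
        push_cast at h
        linarith
      have c2 : ((n + 1).choose (k + 1) : ℚ) * (k + 1) = (n + 1 - k) * (n + 1).choose k := by
        have h : ((n + 1 + 1).choose (k + 1) : ℚ) = (n + 1).choose k + (n + 1).choose (k + 1) := by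
          exact_mod_cast Nat.choose_succ_succ (n + 1) k
        rw [h] at c1
        linear_combination c1
      apply mul_left_cancel₀ hn
      apply mul_left_cancel₀ hk
      push_cast at hA hB ⊢
      linear_combination ((k:ℚ)+1)*(n+2)*hA + ((k:ℚ)+1)*(n+2)*hB - ((n:ℚ)+2) * (n + 1).choose k * hC + ((n:ℚ)+2) * (n+1-a) * NN a (k+1) * c2 - ((n:ℚ)+1)*(n+2-a) * NN a (k+1) * c1

theorem chooseConv_NN (n k : ℕ) (hkn : k ≤ n) (h : n % 2 = k % 2) :
    chooseConv ((((n + k) / 2 : ℕ) : ℤ) - 1) ((k : ℤ) - 1) = NN n k := by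
  unfold chooseConv
  cases k with
  | zero =>
    simp only [NN]
    split_ifs <;> simp_all <;> omega
  | succ k =>
    simp only [NN]
    rw [if_neg (by omega), if_pos (by omega), if_pos (by omega)]
    congr 2 <;> omega

theorem rr_iff {n : ℕ} (k : ℕ) (π : Equiv.Perm (Fin n)) :
    (IsJacobi π ∧ Avoids123 π ∧ lrminCount π = k) ↔ RR n k (fun i => ((π⁻¹ i : Fin n) : ℕ)) := by
  unfold RR
  have hL : ∀ v : Fin n, (∀ w, w < π v → v < π⁻¹ w) ↔ ∀ i, i < v → π v < π i := by
    intro v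
    constructor
    · intro h i hi
      by_contra hc
      rcases lt_or_eq_of_le (not_lt.mp hc) with h1 | h1
      · have := h _ h1
        simp at this
        omega
      · exact hi.ne (π.injective h1)
    · intro h w hw
      by_contra hc
      rcases lt_or_eq_of_le (not_lt.mp hc) with h1 | h1
      · have := h _ h1
        simp at this
        omega
      · rw [← h1] at hw
        simp at hw
  have hinv : ∀ v, π⁻¹ (π v) = v := fun v => by simp
  have e1 : Avoids123 π ↔ (∀ i j l : Fin n, i < j → j < l → ((π⁻¹ i : Fin n) : ℕ) < (π⁻¹ j : Fin n) →
      ¬ ((π⁻¹ j : Fin n) : ℕ) < (π⁻¹ l : Fin n)) := by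
    unfold Avoids123
    constructor
    · intro h i j l h1 h2 h3 h4
      exact h ⟨π⁻¹ i, π⁻¹ j, π⁻¹ l, h3, h4, by simpa, by simpa⟩
    · rintro h ⟨i, j, l, h1, h2, h3, h4⟩
      exact h _ _ _ h3 h4 (by simpa) (by simpa)
  have e4 : lrminCount π = (Finset.univ.filter (fun v : Fin n => ((π⁻¹ v : Fin n) : ℕ) < n ∧
      ∀ w, w < v → ((π⁻¹ v : Fin n) : ℕ) < (π⁻¹ w : Fin n))).card := by
    unfold lrminCount
    rw [Nat.card_congr (π.subtypeEquiv (q := fun v : Fin n => ((π⁻¹ v : Fin n) : ℕ) < n ∧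
      ∀ w, w < v → ((π⁻¹ v : Fin n) : ℕ) < (π⁻¹ w : Fin n)) fun v => ?_)]
    · exact Nat.subtype_card _ (by simp)
    · rw [← hL]
      simp
  have e3 : Avoids123 π → (IsJacobi π ↔ (∀ v : Fin n, ((π⁻¹ v : Fin n) : ℕ) < n →
      (∀ w, w < v → ((π⁻¹ v : Fin n) : ℕ) < (π⁻¹ w : Fin n)) →
    Even ((Finset.range n).filter (fun j => ((π⁻¹ v : Fin n) : ℕ) < j ∧
      ∀ w, w < v → j < (π⁻¹ w : Fin n))).card)) := by
    intro hav
    unfold IsJacobi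
    rw [← π.forall_congr_right (q := fun v : Fin n => ((π⁻¹ v : Fin n) : ℕ) < n →
      (∀ w, w < v → ((π⁻¹ v : Fin n) : ℕ) < (π⁻¹ w : Fin n)) →
    Even ((Finset.range n).filter (fun j => ((π⁻¹ v : Fin n) : ℕ) < j ∧
      ∀ w, w < v → j < (π⁻¹ w : Fin n))).card)]
    refine forall_congr' fun v => ?_
    by_cases hv : ∀ i, i < v → π v < π i
    · have hv' := (hL v).mpr hv
      have : rhoLen π v = ((Finset.range n).filter (fun j => ((π⁻¹ (π v) : Fin n) : ℕ) < j ∧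
          ∀ w, w < π v → j < (π⁻¹ w : Fin n))).card := by
        unfold rhoLen
        classical
        rw [Nat.subtype_card (Finset.univ.filter fun j : Fin n =>
          v < j ∧ ∀ i : Fin n, v < i → i ≤ j → π v < π i) (by simp)]
        rw [← Finset.card_map Fin.valEmbedding]
        congr 1
        ext j
        simp only [Finset.mem_map, Finset.mem_filter, Finset.mem_univ, true_and,
          Finset.mem_range, Fin.valEmbedding_apply, hinv]
        constructor
        · rintro ⟨j, ⟨h1, h2⟩, rfl⟩
          refine ⟨j.2, h1, fun w hw => ?_⟩
          by_contra hc
          have := h2 (π⁻¹ w) (hv' w hw) (by rw [Fin.le_def]; omega)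
          simp at this
          omega
        · rintro ⟨h1, h2, h3⟩
          refine ⟨⟨j, h1⟩, ⟨h2, fun i hi hij => ?_⟩, rfl⟩
          by_contra hc
          rcases lt_or_eq_of_le (not_lt.mp hc) with h4 | h4
          · have := h3 _ h4
            simp at this
            rw [Fin.le_def] at hij
            simp at hij
            omega
          · exact hi.ne' (π.injective h4)
      rw [this]
      simp only [hinv, Fin.is_lt, forall_true_left]
      rw [forall_prop_of_true]
      intro w hw
      exact hv' w hw
    · have : rhoLen π v = 0 := by
        unfold rhoLen
        rw [Nat.card_eq_zero]
        left
        constructor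
        rintro ⟨j, h1, h2⟩
        push Not at hv
        obtain ⟨i, hi, hi2⟩ := hv
        exact hav ⟨i, v, j, hi, h1, lt_of_le_of_ne hi2 (fun h => hi.ne (π.injective h)), h2 j h1 le_rfl⟩
      rw [this]
      simp only [Even.zero, true_iff]
      intro _ h
      exact absurd ((hL v).mp (by simpa using h)) hv
  constructor
  · rintro ⟨h1, h2, h3⟩
    refine ⟨e1.mp h2, ?_, (e3 h2).mp h1, by rw [← e4, h3]⟩
    intro i j _ h
    have := (π⁻¹ i).2
    dsimp only at h
    omega
  · rintro ⟨h1, h2, h3, h4⟩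
    exact ⟨(e3 (e1.mpr h1)).mpr h3, e1.mpr h1, by rw [e4, h4]⟩

theorem card_eq_QQ (n k : ℕ) : Nat.card {π : Equiv.Perm (Fin n) //
          IsJacobi π ∧ Avoids123 π ∧ lrminCount π = k} = QQ n n k := by
  unfold QQ
  refine Nat.card_congr ((Equiv.inv (Equiv.Perm (Fin n))).subtypeEquiv fun π => ?_)
  exact rr_iff k π

/-- Counting 123-avoiding Jacobi permutations of `[n]` by left-to-right minima. -/
theorem jacobi_avoid_123_lrmin (n k : ℕ) (hkn : k ≤ n) :
    (n % 2 = k % 2 →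
      (Nat.card {π : Equiv.Perm (Fin n) //
          IsJacobi π ∧ Avoids123 π ∧ lrminCount π = k} : ℚ)
        = (1 / ((n : ℚ) + 1)) * ((n + 1).choose k : ℕ)
            * (chooseConv ((((n + k) / 2 : ℕ) : ℤ) - 1) ((k : ℤ) - 1) : ℤ)) ∧
    (n % 2 ≠ k % 2 →
      Nat.card {π : Equiv.Perm (Fin n) //
          IsJacobi π ∧ Avoids123 π ∧ lrminCount π = k} = 0) := by
  rw [card_eq_QQ]
  have hF := QQ_formula n n k le_rfl
  have hn : ((n : ℚ) + 1) ≠ 0 := by positivity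
  constructor
  · intro h
    rw [chooseConv_NN n k hkn h]
    field_simp
    push_cast
    linear_combination hF
  · intro h
    have : NN n k = 0 := by
      cases k with
      | zero =>
        simp only [NN]
        rw [if_neg (by rintro rfl; simp at h)]
      | succ k =>
        simp only [NN]
        rw [if_neg (by omega)]
    rw [this] at hF
    simpa [hn] using hF
end
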